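/- For every integer n ≥ 4 there exists a constant C > 0, depending only on n, such that for every integer H ≥ 3, |#R_n(H) − 2·ν_n·H^(n−1)| ≤ C·H^(n−2)·(log H)^(2n²−5n+2), where #R_n(H) is the number of generalized degenerate monic integer polynomials of degree n and height at most H that are reducible over ℤ. -/

import Mathlib

open Polynomial MeasureTheory

/-- A finite set of (nonzero) complex numbers is multiplicatively dependent:
there are integer exponents, not all zero, whose corresponding power product is 1. -/
def MulDep (S : Finset ℂ) : Prop :=
  ∃ k : ℂ → ℤ, (∃ z ∈ S, k z ≠ 0) ∧ ∏ z ∈ S, z ^ k z = 1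

/-- The distinct nonzero complex roots of an integer polynomial. -/
noncomputable def nzRoots (f : Polynomial ℤ) : Finset ℂ :=
  ((f.map (Int.castRingHom ℂ)).roots.toFinset).filter (fun z => z ≠ 0)

/-- A polynomial of degree at least 2 is generalized degenerate if its distinct
nonzero complex roots are multiplicatively dependent. -/
def GenDeg (f : Polynomial ℤ) : Prop :=
  2 ≤ f.natDegree ∧ MulDep (nzRoots f)

/-- Height (max absolute value of coefficients) at most `H`. -/
def HeightLe (f : Polynomial ℤ) (H : ℤ) : Prop :=
  ∀ i, |f.coeff i| ≤ H

def Iset (n : ℕ) (H : ℤ) : Set (Polynomial ℤ) :=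
  {f | f.Monic ∧ f.natDegree = n ∧ HeightLe f H ∧ Irreducible f ∧ GenDeg f}

def Rset (n : ℕ) (H : ℤ) : Set (Polynomial ℤ) :=
  {f | f.Monic ∧ f.natDegree = n ∧ HeightLe f H ∧ ¬ Irreducible f ∧ GenDeg f}

def Mset (n : ℕ) (H : ℤ) : Set (Polynomial ℤ) :=
  {f | f.Monic ∧ f.natDegree = n ∧ HeightLe f H ∧ GenDeg f}

def IstarSet (n : ℕ) (H : ℤ) : Set (Polynomial ℤ) :=
  {f | f.natDegree = n ∧ HeightLe f H ∧ Irreducible f ∧ GenDeg f}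

def RstarSet (n : ℕ) (H : ℤ) : Set (Polynomial ℤ) :=
  {f | f.natDegree = n ∧ HeightLe f H ∧ ¬ Irreducible f ∧ GenDeg f}

def MstarSet (n : ℕ) (H : ℤ) : Set (Polynomial ℤ) :=
  {f | f.natDegree = n ∧ HeightLe f H ∧ GenDeg f}

/-- `nu n` is the (n-1)-dimensional Lebesgue volume of the convex body
`|x_i| ≤ 1 (1 ≤ i ≤ n-1)`, `|x_1 + ⋯ + x_{n-1}| ≤ 1`. -/
noncomputable def nu (n : ℕ) : ℝ :=
  (volume {x : Fin (n - 1) → ℝ | (∀ i, |x i| ≤ 1) ∧ |∑ i, x i| ≤ 1}).toReal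

theorem exists_uniform_torsion_bound (D : ℕ) :
    ∃ T : ℕ, 1 ≤ T ∧ ∀ (K : Type) [Field K] [NumberField K], Module.finrank ℚ K ≤ D →
      ∀ y : K, y ≠ 0 → IsIntegral ℤ y → (∀ φ : K →+* ℂ, ‖φ y‖ ^ T ≤ 2) →
        ∃ j : ℕ, 1 ≤ j ∧ j ≤ T ∧ y ^ j = 1 := by
  classical
  let C : ℕ := 2 ^ D * 2 ^ D
  have hfin := bUnion_roots_finite (algebraMap ℤ ℂ) D (Set.finite_Icc (-C : ℤ) C)
  set R := (⋃ (f : ℤ[X]) (_ : f.natDegree ≤ D ∧ ∀ i, f.coeff i ∈ Set.Icc (-C : ℤ) C),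
        ((f.map (algebraMap ℤ ℂ)).roots.toFinset : Set ℂ)) with hR
  refine ⟨R.ncard + 1, by omega, ?_⟩
  intro K _ _ hK y hy hyi hφ
  obtain ⟨φ₀⟩ : Nonempty (K →+* ℂ) := inferInstance
  have hmem : ∀ j : ℕ, j ≤ R.ncard + 1 → φ₀ (y ^ j) ∈ R := by
    intro j hj
    have hyint : IsIntegral ℤ (y ^ j) := hyi.pow j
    have hb : ∀ φ : K →+* ℂ, ‖φ (y ^ j)‖ ≤ 2 := by
      intro φ
      rw [map_pow, norm_pow]
      rcases le_total ‖φ y‖ 1 with h | h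
      · exact (pow_le_one₀ (norm_nonneg _) h).trans (by norm_num)
      · exact (pow_le_pow_right₀ h hj).trans (hφ φ)
    have hq := minpoly.isIntegrallyClosed_eq_field_fractions' ℚ hyint
    have hdeg : (minpoly ℤ (y ^ j)).natDegree ≤ Module.finrank ℚ K := by
      rw [← (minpoly.monic hyint).natDegree_map (algebraMap ℤ ℚ), ← hq]
      exact minpoly.natDegree_le _
    rw [hR]
    simp only [Set.mem_iUnion]
    refine ⟨minpoly ℤ (y ^ j), ⟨hdeg.trans hK, fun i => ?_⟩, ?_⟩
    · rw [Set.mem_Icc, ← abs_le, ← @Int.cast_le ℝ]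
      have h1 := NumberField.Embeddings.coeff_bdd_of_norm_le hb i
      rw [hq, coeff_map, eq_intCast, Int.norm_cast_rat, Int.norm_eq_abs] at h1
      rw [Int.cast_abs]
      refine h1.trans ?_
      have h2 : max (2 : ℝ) 1 = 2 := by norm_num
      rw [h2]
      have h3 : (Module.finrank ℚ K).choose (Module.finrank ℚ K / 2) ≤ 2 ^ D :=
        (Nat.choose_le_two_pow _ _).trans (Nat.pow_le_pow_right (by norm_num) hK)
      have h4 : (2 : ℝ) ^ Module.finrank ℚ K ≤ 2 ^ D := pow_le_pow_right₀ (by norm_num) hK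
      push_cast [C]
      gcongr
      exact_mod_cast h3
    · simp only [Finset.mem_coe, Multiset.mem_toFinset]
      rw [mem_roots ((minpoly.monic hyint).map _).ne_zero, IsRoot, eval_map_algebraMap]
      have := minpoly.aeval ℤ (y ^ j)
      have h2 := congrArg φ₀.toIntAlgHom this
      rw [← aeval_algHom_apply] at h2
      simpa using h2
  have hinj : ∃ a ∈ Finset.range (R.ncard + 2), ∃ b ∈ Finset.range (R.ncard + 2), a ≠ b ∧
      φ₀ (y ^ a) = φ₀ (y ^ b) := by
    apply Finset.exists_ne_map_eq_of_card_lt_of_maps_to (t := hfin.toFinset)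
    · rw [← Set.ncard_eq_toFinset_card _ hfin, Finset.card_range]
      omega
    · intro j hj
      have := hmem j (by simp at hj; omega)
      simpa using this
  obtain ⟨a, ha, b, hb, hab, heq⟩ := hinj
  wlog hlt : b < a generalizing a b
  · exact this b hb a ha hab.symm heq.symm (by omega)
  have h := φ₀.injective heq
  simp only [Finset.mem_range] at ha hb
  refine ⟨a - b, by omega, by omega, ?_⟩
  rw [← Nat.sub_add_cancel hlt.le, pow_add, mul_left_eq_self₀] at h
  exact h.resolve_right fun hp ↦ hy (eq_zero_of_pow_eq_zero hp)

theorem isIntegral_of_isIntegral_mul {K : Type} [Field K] [NumberField K] {y : K} {D : ℕ}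
    (hD : Module.finrank ℚ K ≤ D) {c : ℂ} {M N : ℕ} (hM : 0 < M)
    (hcN : c ^ M = N) (hN : 0 < N) (hND : N ^ D < 2 ^ M)
    (hφint : ∀ φ : K →+* ℂ, IsIntegral ℤ (φ y * c)) : IsIntegral ℤ y := by
  classical
  have hyint : IsIntegral ℚ y := Algebra.IsSeparable.isIntegral ℚ y
  have hmon := minpoly.monic hyint
  have hdeg : (minpoly ℚ y).natDegree ≤ D := (minpoly.natDegree_le y).trans hD
  have hc : c ≠ 0 := by
    rintro rfl
    rw [zero_pow hM.ne'] at hcN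
    exact hN.ne' (by exact_mod_cast hcN.symm)
  let P : ℂ[X] := ((minpoly ℚ y).map (algebraMap ℚ ℂ)).scaleRoots c
  have hPi : ∀ i, IsIntegral ℤ (P.coeff i) := by
    intro i
    refine isIntegral_coeff_of_factors P ?_ (IsAlgClosed.splits _) ?_ i
    · rw [((monic_scaleRoots_iff c).2 (hmon.map _)).leadingCoeff]
      exact isIntegral_one
    · intro x hx
      have hxc : x = c * (x / c) := by field_simp
      have hx' : ((minpoly ℚ y).map (algebraMap ℚ ℂ)).eval (x / c) = 0 := by
        rw [IsRoot, hxc, scaleRoots_eval_mul] at hx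
        exact (mul_eq_zero.1 hx).resolve_left (pow_ne_zero _ hc)
      have hmem : x / c ∈ (minpoly ℚ y).rootSet ℂ := by
        rw [mem_rootSet_of_ne hmon.ne_zero, ← eval_map_algebraMap]
        exact hx'
      rw [← NumberField.Embeddings.range_eval_eq_rootSet_minpoly K ℂ y] at hmem
      obtain ⟨φ, hφ⟩ := hmem
      have := hφint φ
      simp only at hφ
      rwa [hφ, div_mul_cancel₀ _ hc] at this
  have hcoef : ∀ i, ∃ z : ℤ, (z : ℚ) = (minpoly ℚ y).coeff i := by
    intro i
    set e := (minpoly ℚ y).coeff i with he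
    set j := (minpoly ℚ y).natDegree - i with hj
    have h1 : IsIntegral ℤ ((e : ℂ) * c ^ j) := by
      have := hPi i
      simpa [P, coeff_scaleRoots, natDegree_map, ← he, ← hj] using this
    have h2 : IsIntegral ℤ (algebraMap ℚ ℂ (e ^ M * (N : ℚ) ^ j)) := by
      have h3 := h1.pow M
      have h4 : ((e : ℂ) * c ^ j) ^ M = algebraMap ℚ ℂ (e ^ M * (N : ℚ) ^ j) := by
        rw [mul_pow, ← pow_mul, mul_comm j M, pow_mul, hcN]
        simp
      rwa [h4] at h3
    have h5 : IsIntegral ℤ (e ^ M * (N : ℚ) ^ j) :=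
      (isIntegral_algebraMap_iff (algebraMap ℚ ℂ).injective).1 h2
    obtain ⟨z, hz⟩ := IsIntegrallyClosed.isIntegral_iff.1 h5
    have hz' : (z : ℚ) = e ^ M * (N : ℚ) ^ j := by simpa using hz
    have h6 : e.num ^ M * (N : ℤ) ^ j = z * (e.den : ℤ) ^ M := by
      have : (e.num : ℚ) ^ M * (N : ℚ) ^ j = z * (e.den : ℚ) ^ M := by
        rw [hz', ← Rat.mul_den_eq_num e]
        ring
      exact_mod_cast this
    have h7 : (e.den : ℤ) ^ M ∣ (N : ℤ) ^ j := by
      have hcop : IsCoprime ((e.den : ℤ) ^ M) (e.num ^ M) := by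
        apply IsCoprime.pow
        rw [Int.isCoprime_iff_nat_coprime]
        simpa using e.reduced.symm
      exact hcop.dvd_of_dvd_mul_left ⟨z, by rw [h6]; ring⟩
    have h8 : e.den ^ M ∣ N ^ j := by exact_mod_cast h7
    have h9 : e.den ^ M < 2 ^ M := calc
      e.den ^ M ≤ N ^ j := Nat.le_of_dvd (by positivity) h8
      _ ≤ N ^ D := Nat.pow_le_pow_right hN (by omega)
      _ < 2 ^ M := hND
    have h10 : e.den < 2 := lt_of_pow_lt_pow_left₀ M (by norm_num) h9
    have h11 : e.den = 1 := by have := e.den_pos; omega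
    exact ⟨e.num, (Rat.den_eq_one_iff e).1 h11⟩
  have hlift : minpoly ℚ y ∈ lifts (algebraMap ℤ ℚ) := by
    rw [lifts_iff_coeff_lifts]
    intro i
    obtain ⟨z, hz⟩ := hcoef i
    exact ⟨z, by simpa using hz⟩
  obtain ⟨q, hq, -, hqm⟩ := lifts_and_natDegree_eq_and_monic hlift hmon
  refine ⟨q, hqm, ?_⟩
  have h0 := minpoly.aeval ℚ y
  rw [← hq, aeval_map_algebraMap] at h0
  exact h0

theorem exists_simultaneous_approx {ι : Type*} [Fintype ι] (Q : ι → ℕ) (hQ : ∀ i, 1 ≤ Q i)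
    (θ : ι → ℝ) :
    ∃ q : ℕ, 1 ≤ q ∧ q ≤ ∏ i, Q i ∧ ∃ p : ι → ℤ, ∀ i, |(q : ℝ) * θ i - p i| * Q i < 1 := by
  classical
  let f : ℕ → ι → ℕ := fun q i => ⌊(Q i : ℝ) * Int.fract ((q : ℝ) * θ i)⌋₊
  have hpig : ∃ a ∈ Finset.range (∏ i, Q i + 1), ∃ b ∈ Finset.range (∏ i, Q i + 1), a ≠ b ∧
      f a = f b := by
    apply Finset.exists_ne_map_eq_of_card_lt_of_maps_to
      (t := Fintype.piFinset fun i => Finset.range (Q i))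
    · simp [Fintype.card_piFinset]
    · intro a _
      simp only [Finset.mem_coe, Fintype.mem_piFinset, Finset.mem_range, f]
      intro i
      have hQi : (0 : ℝ) < Q i := by exact_mod_cast hQ i
      rw [Nat.floor_lt (mul_nonneg hQi.le (Int.fract_nonneg _))]
      nlinarith [Int.fract_lt_one ((a : ℝ) * θ i)]
  obtain ⟨a, ha, b, hb, hab, heq⟩ := hpig
  wlog hlt : b < a generalizing a b
  · exact this b hb a ha hab.symm heq.symm (by omega)
  simp only [Finset.mem_range] at ha hb
  refine ⟨a - b, by omega, by omega, fun i => ⌊(a : ℝ) * θ i⌋ - ⌊(b : ℝ) * θ i⌋, fun i => ?_⟩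
  have hQi : (0 : ℝ) < Q i := by exact_mod_cast hQ i
  have h1 := congrFun heq i
  simp only [f] at h1
  have ha1 := Nat.floor_le (mul_nonneg hQi.le (Int.fract_nonneg ((a : ℝ) * θ i)))
  have ha2 := Nat.lt_floor_add_one ((Q i : ℝ) * Int.fract ((a : ℝ) * θ i))
  have hb1 := Nat.floor_le (mul_nonneg hQi.le (Int.fract_nonneg ((b : ℝ) * θ i)))
  have hb2 := Nat.lt_floor_add_one ((Q i : ℝ) * Int.fract ((b : ℝ) * θ i))
  rw [h1] at ha1 ha2
  have h2 : ((a - b : ℕ) : ℝ) * θ i - ((⌊(a : ℝ) * θ i⌋ - ⌊(b : ℝ) * θ i⌋ : ℤ) : ℝ)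
      = Int.fract ((a : ℝ) * θ i) - Int.fract ((b : ℝ) * θ i) := by
    rw [Nat.cast_sub hlt.le]
    push_cast
    simp only [Int.fract]
    ring
  rw [h2, ← Nat.abs_cast (Q i), ← abs_mul, abs_lt]
  constructor <;> nlinarith

theorem isIntegral_zpow_mul_pow {z : ℂ} {N : ℕ} (hz0 : z ≠ 0) (hz : IsIntegral ℤ z)
    (hN : IsIntegral ℤ ((N : ℂ) / z)) {e : ℤ} {A : ℕ} (h : e.natAbs ≤ A) :
    IsIntegral ℤ (z ^ e * (N : ℂ) ^ A) := by
  have hNi : IsIntegral ℤ (N : ℂ) := by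
    simpa using (isIntegral_algebraMap (R := ℤ) (A := ℂ) (x := (N : ℤ)))
  obtain ⟨n, rfl | rfl⟩ := e.eq_nat_or_neg
  · rw [zpow_natCast]
    exact (hz.pow n).mul (hNi.pow A)
  · simp only [Int.natAbs_neg, Int.natAbs_natCast] at h
    have : z ^ (-(n : ℤ)) * (N : ℂ) ^ A = ((N : ℂ) / z) ^ n * (N : ℂ) ^ (A - n) := by
      rw [zpow_neg, zpow_natCast, div_pow, ← Nat.add_sub_of_le h, pow_add, Nat.add_sub_cancel_left]
      field_simp
    rw [this]
    exact (hN.pow n).mul (hNi.pow _)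

theorem zpow_le_two_pow {x : ℝ} {w : ℕ} (hx : 0 < x) (h1 : x ≤ 2 ^ w) (h2 : x⁻¹ ≤ 2 ^ w) (e : ℤ) :
    x ^ e ≤ 2 ^ (w * e.natAbs) := by
  rw [pow_mul]
  obtain ⟨n, rfl | rfl⟩ := e.eq_nat_or_neg
  · simpa using pow_le_pow_left₀ hx.le h1 n
  · simpa using pow_le_pow_left₀ (inv_pos.2 hx).le h2 n

theorem exists_small_relation (D m : ℕ) :
    ∃ C : ℕ, ∀ (K : Type) [Field K] [NumberField K], Module.finrank ℚ K ≤ D →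
      ∀ (ι : Type) [Fintype ι] [DecidableEq ι], Fintype.card ι ≤ m →
      ∀ (z : ι → K) (w N : ι → ℕ), (∀ i, 1 ≤ w i) → (∀ i, 0 < N i) → (∀ i, N i ≤ 2 ^ w i) →
      (∀ i, z i ≠ 0) → (∀ i, IsIntegral ℤ (z i)) → (∀ i, IsIntegral ℤ ((N i : K) / z i)) →
      (∀ (φ : K →+* ℂ) i, ‖φ (z i)‖ ≤ 2 ^ w i) → (∀ (φ : K →+* ℂ) i, ‖φ (z i)‖⁻¹ ≤ 2 ^ w i) →
      ∀ k : ι → ℤ, k ≠ 0 → ∏ i, z i ^ k i = 1 →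
      ∃ p : ι → ℤ, p ≠ 0 ∧ ∏ i, z i ^ p i = 1 ∧
        ∀ i, (p i).natAbs ≤ C * ∏ j ∈ Finset.univ.erase i, w j := by
  obtain ⟨T, hT1, hT⟩ := exists_uniform_torsion_bound D
  set R : ℕ := (m + 1) * T * (D + 1) with hRdef
  refine ⟨T * (R ^ m + 1), ?_⟩
  intro K _ _ hK ι _ _ hm z w N hw hN0 hN hz0 hzi hNi hφ1 hφ2 k hk hrel
  have hR1 : 1 ≤ R := by
    rw [hRdef]; exact Nat.mul_pos (Nat.mul_pos (by omega) hT1) (by omega)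
  obtain ⟨i₁, hi₁⟩ := Function.ne_iff.1 hk
  obtain ⟨i₀, -, hmax⟩ := Finset.exists_max_image Finset.univ (fun i => (k i).natAbs * w i)
    ⟨i₁, Finset.mem_univ _⟩
  simp only [Finset.mem_univ, forall_const] at hmax
  have hk0 : k i₀ ≠ 0 := by
    intro h
    have := hmax i₁
    rw [h] at this
    simp only [Int.natAbs_zero, zero_mul, nonpos_iff_eq_zero, mul_eq_zero, Int.natAbs_eq_zero] at this
    rcases this with h | h
    · exact hi₁ h
    · have := hw i₁; omega
  wlog hpos : 0 < k i₀ generalizing k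
  · refine this (-k) (neg_ne_zero.2 hk) ?_ ?_ ?_ ?_ ?_
    · simp [zpow_neg, hrel]
    · simpa using hi₁
    · simpa using hmax
    · simpa using hk0
    · simp only [Pi.neg_apply]; omega
  -- approximation of the direction of the relation
  obtain ⟨κ, hκ⟩ : ∃ κ : ℕ, k i₀ = κ := ⟨(k i₀).toNat, by omega⟩
  have hκ0 : 0 < κ := by omega
  have hQ1 : ∀ i, 1 ≤ R * w i := fun i => Nat.mul_pos hR1 (hw i)
  obtain ⟨q, hq1, hq2, p, hp⟩ := exists_simultaneous_approx
    (Function.update (fun i => R * w i) i₀ 1)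
    (fun i => by by_cases h : i = i₀ <;> simp [h, hQ1])
    (fun i => (k i : ℝ) / κ)
  have hq3 : q ≤ ∏ i ∈ Finset.univ.erase i₀, (R * w i) := by
    refine hq2.trans_eq ?_
    rw [← Finset.mul_prod_erase _ _ (Finset.mem_univ i₀), Function.update_self, one_mul]
    refine Finset.prod_congr rfl fun i hi => ?_
    rw [Function.update_of_ne (Finset.ne_of_mem_erase hi)]
  have hp0 : p i₀ = q := by
    have h := hp i₀
    rw [Function.update_self, hκ, Int.cast_natCast, div_self (by exact_mod_cast hκ0.ne')] at h
    have h' : |((q : ℤ) - p i₀ : ℤ)| < 1 := by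
      rw [← @Int.cast_lt ℝ]; push_cast; simpa using h
    rw [abs_lt] at h'; omega
  set e : ι → ℤ := fun i => q * k i - p i * κ with he
  have hek : ∀ i, (e i).natAbs * (R * w i) ≤ κ := by
    intro i
    by_cases hi : i = i₀
    · subst hi
      simp [he, hp0, hκ]
    · have h := (hp i).le
      rw [Function.update_of_ne hi] at h
      have hκr : (0 : ℝ) < κ := by exact_mod_cast hκ0
      have h2 : |((e i : ℤ) : ℝ)| = |(q : ℝ) * (k i / κ) - p i| * κ := by
        rw [← abs_of_pos hκr, ← abs_mul, abs_of_pos hκr]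
        congr 1
        simp only [he]; push_cast; field_simp
      have h3 : ((e i).natAbs * (R * w i) : ℝ) ≤ κ := by
        rw [Nat.cast_natAbs, Int.cast_abs, h2]
        push_cast at h
        nlinarith
      exact_mod_cast h3
  set y : K := ∏ i, z i ^ p i with hy
  have hy0 : y ≠ 0 := Finset.prod_ne_zero_iff.2 fun i _ => zpow_ne_zero _ (hz0 i)
  have hyκ : y ^ κ = ∏ i, z i ^ (- e i) := by
    have h1 : ∏ i, z i ^ (- e i) = (∏ i, z i ^ p i) ^ (κ : ℤ) / (∏ i, z i ^ k i) ^ (q : ℤ) := by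
      rw [← Finset.prod_zpow, ← Finset.prod_zpow, ← Finset.prod_div_distrib]
      refine Finset.prod_congr rfl fun i _ => ?_
      rw [← zpow_mul, ← zpow_mul, ← zpow_sub₀ (hz0 i)]
      congr 1
      simp only [he]; ring
    rw [h1, hrel, one_zpow, div_one, zpow_natCast]
  have hι0 : 0 < Fintype.card ι := Fintype.card_pos_iff.2 ⟨i₀⟩
  have hsum : R * ∑ i, w i * (e i).natAbs ≤ m * κ := by
    rw [Finset.mul_sum]
    calc ∑ i, R * (w i * (e i).natAbs) ≤ ∑ _i : ι, κ :=
          Finset.sum_le_sum fun i _ => by have := hek i; nlinarith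
      _ = Fintype.card ι * κ := by simp
      _ ≤ m * κ := Nat.mul_le_mul_right _ hm
  have hnorm : ∀ φ : K →+* ℂ, ‖φ y‖ ^ T ≤ 2 := by
    intro φ
    rcases le_total ‖φ y‖ 1 with h | h
    · exact (pow_le_one₀ (norm_nonneg _) h).trans (by norm_num)
    have h1 : ‖φ y‖ ^ κ ≤ 2 ^ ∑ i, w i * (e i).natAbs := by
      rw [← norm_pow, ← map_pow, hyκ, map_prod, norm_prod, ← Finset.prod_pow_eq_pow_sum]
      refine Finset.prod_le_prod (fun _ _ => norm_nonneg _) fun i _ => ?_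
      rw [map_zpow₀, norm_zpow]
      have := zpow_le_two_pow (norm_pos_iff.2 ((map_ne_zero φ).2 (hz0 i))) (hφ1 φ i) (hφ2 φ i)
        (- e i)
      simpa using this
    have h2 : (‖φ y‖ ^ T) ^ ((m + 1) * κ) ≤ 2 ^ ((m + 1) * κ) := by
      calc (‖φ y‖ ^ T) ^ ((m + 1) * κ) ≤ ‖φ y‖ ^ (κ * R) := by
            rw [← pow_mul]
            refine pow_le_pow_right₀ h ?_
            rw [hRdef]
            nlinarith [Nat.zero_le (T * ((m + 1) * κ) * D)]
        _ = (‖φ y‖ ^ κ) ^ R := by rw [pow_mul]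
        _ ≤ (2 ^ ∑ i, w i * (e i).natAbs) ^ R := pow_le_pow_left₀ (by positivity) h1 _
        _ = 2 ^ (R * ∑ i, w i * (e i).natAbs) := by rw [← pow_mul, mul_comm]
        _ ≤ 2 ^ ((m + 1) * κ) := pow_le_pow_right₀ (by norm_num) (by nlinarith)
    exact le_of_pow_le_pow_left₀ (by positivity) (by norm_num) h2
  set M : ℕ := ∏ i, (R * w i) with hM
  have hM0 : 0 < M := Finset.prod_pos fun i _ => hQ1 i
  have hMdiv : ∀ i, (R * w i) * (M / (R * w i)) = M := fun i =>
    Nat.mul_div_cancel' (Finset.dvd_prod_of_mem _ (Finset.mem_univ i))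
  set B : ℕ := ∏ i, N i ^ (M / (R * w i)) with hB
  have hB0 : 0 < B := Finset.prod_pos fun i _ => pow_pos (hN0 i) _
  obtain ⟨c, hc⟩ := IsAlgClosed.exists_pow_nat_eq (B : ℂ) hM0
  have hBD : B ^ D < 2 ^ M := by
    have h1 : B ≤ 2 ^ ∑ i, w i * (M / (R * w i)) := by
      rw [hB, ← Finset.prod_pow_eq_pow_sum]
      refine Finset.prod_le_prod' fun i _ => ?_
      rw [pow_mul]
      exact Nat.pow_le_pow_left (hN i) _
    have h2 : R * ∑ i, w i * (M / (R * w i)) ≤ m * M := by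
      rw [Finset.mul_sum]
      calc ∑ i, R * (w i * (M / (R * w i))) = ∑ _i : ι, M :=
            Finset.sum_congr rfl fun i _ => by rw [← mul_assoc]; exact hMdiv i
        _ = Fintype.card ι * M := by simp
        _ ≤ m * M := Nat.mul_le_mul_right _ hm
    calc B ^ D ≤ (2 ^ ∑ i, w i * (M / (R * w i))) ^ D := Nat.pow_le_pow_left h1 _
      _ = 2 ^ ((∑ i, w i * (M / (R * w i))) * D) := by rw [← pow_mul]
      _ < 2 ^ M := by
        refine Nat.pow_lt_pow_right (by norm_num) ?_
        by_contra hcon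
        push Not at hcon
        have h3 : R * M ≤ m * M * D := by
          calc R * M ≤ R * ((∑ i, w i * (M / (R * w i))) * D) := Nat.mul_le_mul_left _ hcon
            _ = (R * ∑ i, w i * (M / (R * w i))) * D := by ring
            _ ≤ m * M * D := Nat.mul_le_mul_right _ h2
        have h4 : R ≤ m * D := by
          have : R * M ≤ (m * D) * M := by nlinarith
          exact Nat.le_of_mul_le_mul_right this hM0
        have h5 : (m + 1) * (D + 1) ≤ R := by
          rw [hRdef]
          calc (m + 1) * (D + 1) = (m + 1) * 1 * (D + 1) := by ring
            _ ≤ _ := by gcongr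
        nlinarith
  have hyint : IsIntegral ℤ y := by
    refine isIntegral_of_isIntegral_mul hK hM0 hc hB0 hBD fun φ => ?_
    have h1 : (φ y * c) ^ (κ * M) =
        ∏ i, (φ (z i) ^ (- e i * M) * (N i : ℂ) ^ (κ * (M / (R * w i)))) := by
      rw [mul_pow, mul_comm κ M, pow_mul c, hc, mul_comm M κ, pow_mul, ← map_pow, hyκ, hB,
        Finset.prod_mul_distrib, map_prod, ← Finset.prod_pow, Nat.cast_prod, ← Finset.prod_pow]
      congr 1
      · refine Finset.prod_congr rfl fun i _ => ?_
        rw [map_zpow₀, zpow_mul, zpow_natCast]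
      · refine Finset.prod_congr rfl fun i _ => ?_
        rw [Nat.cast_pow, ← pow_mul, mul_comm]
    refine IsIntegral.of_pow (Nat.mul_pos hκ0 hM0) ?_
    rw [h1]
    refine IsIntegral.prod _ fun i _ => ?_
    refine isIntegral_zpow_mul_pow ((map_ne_zero φ).2 (hz0 i)) ((hzi i).map φ.toIntAlgHom) ?_ ?_
    · simpa using (hNi i).map φ.toIntAlgHom
    · rw [Int.natAbs_mul, Int.natAbs_neg, Int.natAbs_natCast]
      calc (e i).natAbs * M = (e i).natAbs * (R * w i) * (M / (R * w i)) := by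
            rw [mul_assoc, hMdiv]
        _ ≤ κ * (M / (R * w i)) := Nat.mul_le_mul_right _ (hek i)
  obtain ⟨j, hj1, hjT, hyj⟩ := hT K hK y hy0 hyint hnorm
  refine ⟨fun i => j * p i, ?_, ?_, ?_⟩
  · intro h
    have := congrFun h i₀
    simp only [hp0, Pi.zero_apply, mul_eq_zero, Nat.cast_eq_zero] at this
    omega
  · rw [← hyj, hy, ← Finset.prod_pow]
    refine Finset.prod_congr rfl fun i _ => ?_
    beta_reduce
    rw [mul_comm, zpow_mul, zpow_natCast]
  · intro i
    have hmpos : ∀ s : Finset ι, 1 ≤ ∏ j ∈ s, w j := fun s =>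
      Finset.one_le_prod' fun j _ => hw j
    have hqw : q * w i₀ ≤ R ^ m * ∏ j, w j := by
      calc q * w i₀ ≤ (∏ i ∈ Finset.univ.erase i₀, (R * w i)) * w i₀ := Nat.mul_le_mul_right _ hq3
        _ = R ^ (Finset.univ.erase i₀).card * ∏ j, w j := by
          rw [Finset.prod_mul_distrib, Finset.prod_const, mul_assoc,
            Finset.prod_erase_mul _ _ (Finset.mem_univ i₀)]
        _ ≤ R ^ m * ∏ j, w j := by
          refine Nat.mul_le_mul_right _ (Nat.pow_le_pow_right hR1 ?_)
          exact (Finset.card_le_univ _).trans hm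
    have hpk : (p i).natAbs * κ ≤ q * (k i).natAbs + (e i).natAbs := by
      have : p i * κ = q * k i + (- e i) := by simp only [he]; ring
      calc (p i).natAbs * κ = (p i * κ).natAbs := by rw [Int.natAbs_mul, Int.natAbs_natCast]
        _ ≤ (q * k i).natAbs + (- e i).natAbs := by rw [this]; exact Int.natAbs_add_le _ _
        _ = _ := by rw [Int.natAbs_mul, Int.natAbs_natCast, Int.natAbs_neg]
    have hek' : (e i).natAbs ≤ κ := (Nat.le_mul_of_pos_right _ (hQ1 i)).trans (hek i)
    have hmi := hmax i
    rw [hκ, Int.natAbs_natCast] at hmi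
    have h1 : (p i).natAbs * w i * κ ≤ (q * w i₀ + w i) * κ := by
      calc (p i).natAbs * w i * κ = ((p i).natAbs * κ) * w i := by ring
        _ ≤ (q * (k i).natAbs + κ) * w i := by gcongr; omega
        _ = q * ((k i).natAbs * w i) + κ * w i := by ring
        _ ≤ q * (κ * w i₀) + κ * w i := by gcongr
        _ = _ := by ring
    have h2 := Nat.le_of_mul_le_mul_right h1 hκ0
    have h3 : (p i).natAbs * w i ≤ ((R ^ m + 1) * ∏ j ∈ Finset.univ.erase i, w j) * w i := by
      have h4 := Finset.prod_erase_mul _ w (Finset.mem_univ i)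
      calc (p i).natAbs * w i ≤ q * w i₀ + w i := h2
        _ ≤ R ^ m * ∏ j, w j + (∏ j ∈ Finset.univ.erase i, w j) * w i := by
          have := hmpos (Finset.univ.erase i)
          gcongr
          exact Nat.le_mul_of_pos_left _ this
        _ = _ := by rw [← h4]; ring
    have h5 := Nat.le_of_mul_le_mul_right h3 (hw i)
    rw [Int.natAbs_mul, Int.natAbs_natCast, mul_assoc T]
    exact Nat.mul_le_mul hjT h5

theorem isHomogeneous_esymm (σ R : Type*) [Fintype σ] [CommSemiring R] (n : ℕ) :
    (MvPolynomial.esymm σ R n).IsHomogeneous n := by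
  classical
  unfold MvPolynomial.esymm
  refine MvPolynomial.IsHomogeneous.sum _ _ _ fun t ht => ?_
  have := MvPolynomial.IsHomogeneous.prod t (fun i => (MvPolynomial.X i : MvPolynomial σ R))
    (fun _ => 1) (fun i _ => MvPolynomial.isHomogeneous_X _ _)
  simpa [(Finset.mem_powersetCard.1 ht).2] using this

theorem aeval_esymm_injective (R : Type*) [CommRing R] (d : ℕ) : Function.Injective
    (MvPolynomial.aeval (R := R) fun i : Fin d => MvPolynomial.esymm (Fin d) R (i + 1)) := by
  intro P Q h
  apply MvPolynomial.esymmAlgHom_fin_injective (R := R) (le_refl d)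
  apply Subtype.ext
  have h1 := MvPolynomial.esymmAlgHom_apply (σ := Fin d) P
  have h2 := MvPolynomial.esymmAlgHom_apply (σ := Fin d) Q
  rw [h1, h2]
  exact h

theorem homogeneousComponent_aeval_esymm (R : Type*) [CommRing R] (d m : ℕ)
    (P : MvPolynomial (Fin d) R) :
    MvPolynomial.homogeneousComponent m
      (MvPolynomial.aeval (fun i : Fin d => MvPolynomial.esymm (Fin d) R (i + 1)) P) =
    MvPolynomial.aeval (fun i : Fin d => MvPolynomial.esymm (Fin d) R (i + 1))
      (MvPolynomial.weightedHomogeneousComponent (fun i : Fin d => (i : ℕ) + 1) m P) := by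
  induction P using MvPolynomial.induction_on' with
  | monomial u a =>
    have hl : MvPolynomial.monomial u a ∈ MvPolynomial.weightedHomogeneousSubmodule R
        (fun i : Fin d => (i : ℕ) + 1) (Finsupp.weight (fun i : Fin d => (i : ℕ) + 1) u) :=
      MvPolynomial.isWeightedHomogeneous_monomial _ _ _ rfl
    have hr : MvPolynomial.aeval (fun i : Fin d => MvPolynomial.esymm (Fin d) R (i + 1))
        (MvPolynomial.monomial u a) ∈ MvPolynomial.homogeneousSubmodule (Fin d) R
          (Finsupp.weight (fun i : Fin d => (i : ℕ) + 1) u) := by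
      rw [MvPolynomial.mem_homogeneousSubmodule, MvPolynomial.aeval_monomial]
      have h1 := MvPolynomial.IsHomogeneous.prod Finset.univ
        (fun i : Fin d => MvPolynomial.esymm (Fin d) R (i + 1) ^ u i)
        (fun i => ((i : ℕ) + 1) * u i) (fun i _ => (isHomogeneous_esymm _ _ _).pow _)
      have h2 := (MvPolynomial.isHomogeneous_C (Fin d) a).mul h1
      rw [zero_add] at h2
      rw [Finsupp.prod_fintype _ _ (by simp), Finsupp.weight_apply,
        Finsupp.sum_fintype _ _ (by simp)]
      simpa [mul_comm] using h2
    rw [MvPolynomial.homogeneousComponent_of_mem hr,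
      MvPolynomial.weightedHomogeneousComponent_of_mem hl]
    split_ifs <;> simp
  | add p q hp hq => simp only [map_add, hp, hq]

theorem totalDegree_le_totalDegree_aeval_esymm {R : Type*} [CommRing R] {d : ℕ}
    (P : MvPolynomial (Fin d) R) :
    P.totalDegree ≤
      (MvPolynomial.aeval (fun i : Fin d => MvPolynomial.esymm (Fin d) R (i + 1)) P).totalDegree := by
  classical
  rw [MvPolynomial.totalDegree]
  refine Finset.sup_le fun u hu => ?_
  set w : Fin d → ℕ := fun i => (i : ℕ) + 1
  have h1 : MvPolynomial.weightedHomogeneousComponent w (Finsupp.weight w u) P ≠ 0 := by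
    intro h0
    have := MvPolynomial.coeff_weightedHomogeneousComponent (w := w) (n := Finsupp.weight w u)
      (φ := P) u
    rw [h0, if_pos rfl] at this
    exact (MvPolynomial.mem_support_iff.1 hu) (by simpa using this.symm)
  have h2 : Finsupp.weight w u ≤
      (MvPolynomial.aeval (fun i : Fin d => MvPolynomial.esymm (Fin d) R (i + 1)) P).totalDegree := by
    by_contra! hlt
    have h3 := MvPolynomial.homogeneousComponent_eq_zero _ _ hlt
    rw [homogeneousComponent_aeval_esymm] at h3
    exact h1 (aeval_esymm_injective R d (by rw [h3, map_zero]))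
  refine le_trans ?_ h2
  rw [Finsupp.weight_apply]
  refine Finset.sum_le_sum fun i _ => ?_
  simp [w, mul_add]

/-- The vector of elementary symmetric functions of `β`. -/
noncomputable def esymmVec {d : ℕ} (β : Fin d → ℂ) : Fin d → ℂ :=
  fun i => MvPolynomial.aeval β (MvPolynomial.esymm (Fin d) ℂ (i + 1))

theorem exists_vanishing_polynomial {d : ℕ} (c : ℂ) (hc : c ≠ 0) (p : Fin d → ℤ) (hp : p ≠ 0) :
    ∃ P : MvPolynomial (Fin d) ℂ, P ≠ 0 ∧ P.totalDegree ≤ d.factorial * ∑ i, (p i).natAbs ∧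
      ∀ β : Fin d → ℂ, (∀ i, β i ≠ 0) → c * ∏ i, β i ^ p i = 1 →
        MvPolynomial.eval (esymmVec β) P = 0 := by
  classical
  set pp : Fin d →₀ ℕ := Finsupp.equivFunOnFinite.symm fun i => (p i).toNat with hpp
  set pm : Fin d →₀ ℕ := Finsupp.equivFunOnFinite.symm fun i => (-p i).toNat with hpm
  set s0 : MvPolynomial (Fin d) ℂ := MvPolynomial.monomial pp c - MvPolynomial.monomial pm 1
    with hs0
  have hne : pp ≠ pm := by
    intro h
    apply hp
    funext i
    have := DFunLike.congr_fun h i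
    simp [hpp, hpm] at this
    simp only [Pi.zero_apply]
    omega
  have hs0ne : s0 ≠ 0 := by
    intro h
    have := congrArg (MvPolynomial.coeff pp) h
    simp [hs0, MvPolynomial.coeff_monomial, hne.symm, hc] at this
  have hdeg0 : s0.totalDegree ≤ ∑ i, (p i).natAbs := by
    refine (MvPolynomial.totalDegree_sub _ _).trans (max_le ?_ ?_)
    · refine (MvPolynomial.totalDegree_monomial_le _ _).trans ?_
      rw [Finsupp.sum_fintype _ _ (by simp)]
      refine Finset.sum_le_sum fun i _ => ?_
      change (p i).toNat ≤ (p i).natAbs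
      omega
    · refine (MvPolynomial.totalDegree_monomial_le _ _).trans ?_
      rw [Finsupp.sum_fintype _ _ (by simp)]
      refine Finset.sum_le_sum fun i _ => ?_
      change (-p i).toNat ≤ (p i).natAbs
      omega
  set s : MvPolynomial (Fin d) ℂ := ∏ σ : Equiv.Perm (Fin d), MvPolynomial.rename σ s0 with hs
  have hsne : s ≠ 0 := by
    rw [hs, Finset.prod_ne_zero_iff]
    intro σ _ h
    exact hs0ne (MvPolynomial.rename_injective _ σ.injective (by rw [h, map_zero]))
  have hsymm : s.IsSymmetric := by
    intro τ
    rw [hs, map_prod]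
    refine Fintype.prod_equiv (Equiv.mulLeft τ) _ _ fun σ => ?_
    rw [MvPolynomial.rename_rename]
    rfl
  have hdeg : s.totalDegree ≤ d.factorial * ∑ i, (p i).natAbs := by
    refine (MvPolynomial.totalDegree_finsetProd _ _).trans ?_
    refine (Finset.sum_le_card_nsmul _ _ (∑ i, (p i).natAbs) fun σ _ =>
      (MvPolynomial.totalDegree_rename_le _ _).trans hdeg0).trans ?_
    simp [Fintype.card_perm]
  obtain ⟨P, hP⟩ := MvPolynomial.esymmAlgHom_surjective (σ := Fin d) (R := ℂ) (n := d)
    (by simp) ⟨s, hsymm⟩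
  have hP' : MvPolynomial.aeval (fun i : Fin d => MvPolynomial.esymm (Fin d) ℂ (i + 1)) P = s := by
    rw [← MvPolynomial.esymmAlgHom_apply, hP]
  refine ⟨P, ?_, ?_, ?_⟩
  · rintro rfl
    exact hsne (by rw [← hP', map_zero])
  · exact (totalDegree_le_totalDegree_aeval_esymm P).trans (hP' ▸ hdeg)
  · intro β hβ hrel
    have h1 : MvPolynomial.eval (esymmVec β) P = MvPolynomial.aeval β s := by
      rw [← hP', ← MvPolynomial.aeval_eq_eval, MvPolynomial.comp_aeval_apply]
      rfl
    rw [h1, hs, map_prod]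
    refine Finset.prod_eq_zero (Finset.mem_univ 1) ?_
    have : MvPolynomial.rename (⇑(1 : Equiv.Perm (Fin d))) s0 = s0 := by
      exact MvPolynomial.rename_id_apply s0
    rw [this, hs0, map_sub, MvPolynomial.aeval_monomial, MvPolynomial.aeval_monomial,
      Finsupp.prod_fintype _ _ (by simp), Finsupp.prod_fintype _ _ (by simp), sub_eq_zero]
    simp only [map_one, one_mul, Algebra.algebraMap_self, RingHom.id_apply]
    have hm : ∏ i, β i ^ pm i ≠ 0 := Finset.prod_ne_zero_iff.2 fun i _ => pow_ne_zero _ (hβ i)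
    have : ∏ i, β i ^ p i = (∏ i, β i ^ pp i) / ∏ i, β i ^ pm i := by
      rw [← Finset.prod_div_distrib]
      refine Finset.prod_congr rfl fun i _ => ?_
      rw [← zpow_natCast, ← zpow_natCast, ← zpow_sub₀ (hβ i)]
      congr 1
      simp [hpp, hpm]
    rw [this, ← mul_div_assoc, div_eq_one_iff_eq hm] at hrel
    exact hrel

/-- Monic integer polynomials of degree `d` whose lower coefficients are bounded by `B`. -/
def monicBox (d B : ℕ) : Set ℤ[X] :=
  {f | f.Monic ∧ f.natDegree = d ∧ ∀ i < d, |f.coeff i| ≤ (B : ℤ)}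

theorem monicBox_ext {d : ℕ} {f g : ℤ[X]} (hf : f.Monic) (hfd : f.natDegree = d) (hg : g.Monic)
    (hgd : g.natDegree = d) (h : ∀ i < d, f.coeff i = g.coeff i) : f = g := by
  ext i
  rcases lt_trichotomy i d with hi | rfl | hi
  · exact h i hi
  · rw [← hfd, hf.coeff_natDegree, hfd, ← hgd, hg.coeff_natDegree]
  · rw [coeff_eq_zero_of_natDegree_lt (hfd ▸ hi), coeff_eq_zero_of_natDegree_lt (hgd ▸ hi)]

theorem monicBox_finite_and_ncard_le (d B : ℕ) :
    (monicBox d B).Finite ∧ (monicBox d B).ncard ≤ (2 * B + 1) ^ d := by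
  classical
  set T : Finset (Fin d → ℤ) := Fintype.piFinset fun _ => Finset.Icc (-(B : ℤ)) B
  have hmap : Set.MapsTo (fun (f : ℤ[X]) (i : Fin d) => f.coeff i) (monicBox d B) (T : Set _) := by
    intro f hf
    simp only [T, Finset.mem_coe, Fintype.mem_piFinset, Finset.mem_Icc]
    exact fun i => abs_le.1 (hf.2.2 i i.2)
  have hinj : Set.InjOn (fun (f : ℤ[X]) (i : Fin d) => f.coeff i) (monicBox d B) := by
    intro f hf g hg h
    exact monicBox_ext hf.1 hf.2.1 hg.1 hg.2.1 fun i hi => congrFun h ⟨i, hi⟩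
  refine ⟨Set.Finite.of_injOn hmap hinj T.finite_toSet, ?_⟩
  refine (Set.ncard_le_ncard_of_injOn _ hmap hinj T.finite_toSet).trans ?_
  rw [Set.ncard_coe_finset]
  simp only [T, Fintype.card_piFinset, Int.card_Icc, Finset.prod_const, Finset.card_univ,
    Fintype.card_fin]
  refine Nat.pow_le_pow_left ?_ _
  omega

theorem esymmVec_eq_coeff {d : ℕ} {h : ℤ[X]} {β : Fin d → ℂ}
    (hβ : h.map (Int.castRingHom ℂ) = ∏ i, (X - C (β i))) (i : Fin d) :
    esymmVec β i = (((-1) ^ ((i : ℕ) + 1) * h.coeff (d - (i + 1)) : ℤ) : ℂ) := by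
  have h1 : ((h.coeff (d - (i + 1)) : ℤ) : ℂ) = (∏ i, (X - C (β i))).coeff (d - (i + 1)) := by
    rw [← hβ, coeff_map]; rfl
  have h2 := Multiset.prod_X_sub_C_coeff (Finset.univ.val.map β) (k := d - (i + 1)) (by simp)
  have h3 : ((Finset.univ.val.map β).map fun t => X - C t).prod = ∏ i, (X - C (β i)) := by
    rw [Multiset.map_map]
    rfl
  rw [h3] at h2
  have h4 : Multiset.card (Finset.univ.val.map β) - (d - ((i : ℕ) + 1)) = i + 1 := by
    have := i.2
    simp
    omega
  rw [h4] at h2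
  push_cast
  rw [h1, h2, esymmVec, MvPolynomial.aeval_esymm_eq_multiset_esymm, ← mul_assoc, ← mul_pow]
  simp

theorem ncard_monicBox_relation_le {d : ℕ} (hd : 1 ≤ d) (B : ℕ) (c : ℂ) (hc : c ≠ 0)
    (p : Fin d → ℤ) (hp : p ≠ 0) :
    {h ∈ monicBox d B | ∃ β : Fin d → ℂ, (∀ i, β i ≠ 0) ∧
      h.map (Int.castRingHom ℂ) = ∏ i, (X - C (β i)) ∧ c * ∏ i, β i ^ p i = 1}.ncard ≤
      d.factorial * (∑ i, (p i).natAbs) * (2 * B + 1) ^ (d - 1) := by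
  classical
  obtain ⟨P, hP0, hPd, hP⟩ := exists_vanishing_polynomial c hc p hp
  set S : Finset ℂ := (Finset.Icc (-(B : ℤ)) B).image (Int.cast : ℤ → ℂ) with hS
  have hScard : S.card = 2 * B + 1 := by
    rw [hS, Finset.card_image_of_injective _ Int.cast_injective, Int.card_Icc]
    omega
  set F : Finset (Fin d → ℂ) := {f ∈ Fintype.piFinset fun _ => S | MvPolynomial.eval f P = 0}
  have hcount : F.card ≤ d.factorial * (∑ i, (p i).natAbs) * (2 * B + 1) ^ (d - 1) := by
    have h1 := MvPolynomial.schwartz_zippel_totalDegree hP0 S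
    rw [hScard, div_le_div_iff₀ (by positivity) (by positivity)] at h1
    have h2 : F.card * (2 * B + 1) ≤ P.totalDegree * (2 * B + 1) ^ d := by exact_mod_cast h1
    obtain ⟨e, rfl⟩ : ∃ e, d = e + 1 := ⟨d - 1, by omega⟩
    rw [pow_succ, ← mul_assoc] at h2
    refine (Nat.le_of_mul_le_mul_right h2 (by positivity)).trans ?_
    rw [Nat.add_sub_cancel]
    exact Nat.mul_le_mul_right _ hPd
  rw [← Set.ncard_coe_finset] at hcount
  refine le_trans (Set.ncard_le_ncard_of_injOn (fun (h : ℤ[X]) (i : Fin d) =>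
    (((-1) ^ ((i : ℕ) + 1) * h.coeff (d - (i + 1)) : ℤ) : ℂ)) ?_ ?_ F.finite_toSet) hcount
  · rintro h ⟨hh, β, hβ0, hβ, hrel⟩
    rw [Finset.mem_coe, Finset.mem_filter, Fintype.mem_piFinset]
    constructor
    · intro i
      rw [hS, Finset.mem_image]
      refine ⟨_, ?_, rfl⟩
      rw [Finset.mem_Icc, ← abs_le, abs_mul, abs_pow]
      simpa using hh.2.2 (d - (i + 1)) (by have := i.2; omega)
    · have := hP β hβ0 hrel
      rwa [show esymmVec β = _ from funext (esymmVec_eq_coeff hβ)] at this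
  · rintro h ⟨hh, -⟩ h' ⟨hh', -⟩ heq
    refine monicBox_ext hh.1 hh.2.1 hh'.1 hh'.2.1 fun i hi => ?_
    have h1 := congrFun heq ⟨d - 1 - i, by omega⟩
    have h2 : d - (d - 1 - i + 1) = i := by omega
    simp only [h2, Int.cast_inj] at h1
    exact mul_left_cancel₀ (pow_ne_zero _ (by norm_num)) h1

/-- The Mahler measure of an integer polynomial. -/
noncomputable def intMahler (f : ℤ[X]) : ℝ := (f.map (Int.castRingHom ℂ)).mahlerMeasure

theorem intMahler_mul (f g : ℤ[X]) : intMahler (f * g) = intMahler f * intMahler g := by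
  rw [intMahler, Polynomial.map_mul, mahlerMeasure_mul]; rfl

theorem one_le_intMahler {f : ℤ[X]} (hf : f.Monic) : 1 ≤ intMahler f :=
  one_le_mahlerMeasure_of_one_le_norm_leadingCoeff (by rw [(hf.map _).leadingCoeff]; simp)

theorem abs_coeff_le_intMahler (f : ℤ[X]) (i : ℕ) :
    (|f.coeff i| : ℝ) ≤ 2 ^ f.natDegree * intMahler f := by
  have h := norm_coeff_le_choose_mul_mahlerMeasure i (f.map (Int.castRingHom ℂ))
  rw [coeff_map, natDegree_map_eq_of_injective (RingHom.injective_int _)] at h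
  refine le_trans (by simp) (h.trans ?_)
  refine mul_le_mul_of_nonneg_right ?_ (mahlerMeasure_nonneg _)
  exact_mod_cast Nat.choose_le_two_pow _ _

theorem intMahler_le_of_abs_coeff_le {f : ℤ[X]} {H : ℕ} (hf : ∀ i, |f.coeff i| ≤ (H : ℤ)) :
    intMahler f ≤ (f.natDegree + 1 : ℕ) * H := by
  refine (mahlerMeasure_le_sum_norm_coeff _).trans ?_
  rw [sum_over_range _ (by simp), natDegree_map_eq_of_injective (RingHom.injective_int _)]
  refine (Finset.sum_le_card_nsmul _ _ (H : ℝ) fun i _ => ?_).trans ?_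
  · rw [coeff_map]
    simp only [eq_intCast, Complex.norm_intCast]
    exact_mod_cast hf i
  · simp

theorem norm_root_le_intMahler {f : ℤ[X]} (hf : f.Monic) {z : ℂ}
    (hz : z ∈ (f.map (Int.castRingHom ℂ)).roots) : ‖z‖ ≤ intMahler f := by
  classical
  rw [intMahler, mahlerMeasure_eq_leadingCoeff_mul_prod_roots, (hf.map _).leadingCoeff, norm_one,
    one_mul, ← Multiset.cons_erase hz, Multiset.map_cons, Multiset.prod_cons]
  refine (le_max_right 1 _).trans (le_mul_of_one_le_right (by positivity) ?_)
  refine Multiset.one_le_prod fun x hx => ?_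
  obtain ⟨y, -, rfl⟩ := Multiset.mem_map.1 hx
  exact le_max_left _ _

theorem norm_inv_root_le_intMahler {f : ℤ[X]} (hf : f.Monic) (h0 : f.coeff 0 ≠ 0) {z : ℂ}
    (hz : z ∈ (f.map (Int.castRingHom ℂ)).roots) : ‖z‖⁻¹ ≤ intMahler f := by
  classical
  set g := f.map (Int.castRingHom ℂ) with hg
  have hc := (IsAlgClosed.splits g).coeff_zero_eq_prod_roots_of_monic (hf.map _)
  have hc1 : (1 : ℝ) ≤ ‖g.coeff 0‖ := by
    rw [hg, coeff_map]
    simp only [eq_intCast, Complex.norm_intCast]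
    exact_mod_cast Int.one_le_abs h0
  rw [hc] at hc1
  have h1 : ‖g.roots.prod‖ = ‖z‖ * ((g.roots.erase z).map fun a => ‖a‖).prod := by
    conv_lhs => rw [← Multiset.cons_erase hz, Multiset.prod_cons, norm_mul]
    congr 1
    exact map_multiset_prod (normHom (α := ℂ)) _
  have h2 : ((g.roots.erase z).map fun a => ‖a‖).prod ≤ intMahler f := by
    rw [intMahler, mahlerMeasure_eq_leadingCoeff_mul_prod_roots, (hf.map _).leadingCoeff, norm_one,
      one_mul, ← hg]
    conv_rhs => rw [← Multiset.cons_erase hz, Multiset.map_cons, Multiset.prod_cons]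
    refine le_trans ?_ (le_mul_of_one_le_left ?_ (le_max_left 1 _))
    · exact Multiset.prod_map_le_prod_map₀ _ _ (fun _ _ => norm_nonneg _)
        fun _ _ => le_max_right _ _
    · exact Multiset.prod_nonneg fun x hx => by
        obtain ⟨y, -, rfl⟩ := Multiset.mem_map.1 hx
        positivity
  have h3 : 1 ≤ ‖z‖ * intMahler f := by
    refine hc1.trans ?_
    simp only [one_mul, norm_mul, norm_pow, norm_neg, norm_one, one_pow]
    rw [h1]
    exact mul_le_mul_of_nonneg_left h2 (norm_nonneg _)
  have hz0 : 0 < ‖z‖ := by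
    rcases (norm_nonneg z).eq_or_lt with h | h
    · rw [← h, zero_mul] at h3
      exact absurd h3 (by norm_num)
    · exact h
  rwa [inv_le_iff_one_le_mul₀ hz0, mul_comm]

/-- Monic polynomials of degree `n` and height at most `H` that split off monic factors of degree
at least two on both sides. -/
def nonlinearSplit (n H : ℕ) : Set ℤ[X] :=
  {f | f.Monic ∧ f.natDegree = n ∧ (∀ i, |f.coeff i| ≤ (H : ℤ)) ∧
    ∃ g h : ℤ[X], g.Monic ∧ h.Monic ∧ 2 ≤ g.natDegree ∧ g.natDegree ≤ h.natDegree ∧ f = g * h}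

theorem nonlinearSplit_subset (n H : ℕ) :
    nonlinearSplit n H ⊆
      ⋃ t ∈ {k ∈ Finset.range (n + 1) | 2 ≤ k ∧ k ≤ n - k} ×ˢ
          Finset.range (Nat.log 2 ((n + 1) * H) + 1),
        (fun x : ℤ[X] × ℤ[X] => x.1 * x.2) ''
          (monicBox t.1 (2 ^ t.1 * 2 ^ (t.2 + 1)) ×ˢ
            monicBox (n - t.1) (2 ^ (n + 1) * ((n + 1) * H / 2 ^ t.2))) := by
  rintro f ⟨hf, hfn, hH, g, h, hg, hh, hg2, hgh, rfl⟩
  have hdeg : g.natDegree + h.natDegree = n := by rw [← hfn, hg.natDegree_mul hh]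
  set Y := (n + 1) * H with hY
  set m := Nat.floor (intMahler g) with hm
  have hg1 := one_le_intMahler hg
  have hh1 := one_le_intMahler hh
  have hm1 : 1 ≤ m := Nat.le_floor (by simpa using hg1)
  have hgY : intMahler g * intMahler h ≤ Y := by
    rw [← intMahler_mul]
    refine (intMahler_le_of_abs_coeff_le hH).trans ?_
    rw [hfn, hY]
    push_cast
    rfl
  have hmg : (m : ℝ) ≤ intMahler g := Nat.floor_le (by linarith)
  have hmY : m ≤ Y := by
    have : (m : ℝ) ≤ Y := hmg.trans ((le_mul_of_one_le_right (by linarith) hh1).trans hgY)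
    exact_mod_cast this
  set j := Nat.log 2 m with hj
  have hjm : 2 ^ j ≤ m := Nat.pow_log_le_self 2 (by omega)
  have hmj : m + 1 ≤ 2 ^ (j + 1) := Nat.lt_pow_succ_log_self (by norm_num) m
  have hgj : intMahler g ≤ 2 ^ (j + 1) := by
    have h1 : intMahler g < m + 1 := Nat.lt_floor_add_one _
    have h2 : ((m + 1 : ℕ) : ℝ) ≤ ((2 ^ (j + 1) : ℕ) : ℝ) := by exact_mod_cast hmj
    push_cast at h2
    linarith
  have hB1 : 1 ≤ Y / 2 ^ j := (Nat.one_le_div_iff (by positivity)).2 (hjm.trans hmY)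
  have hhj : intMahler h ≤ 2 * (Y / 2 ^ j : ℕ) := by
    have h1 : (2 : ℝ) ^ j * intMahler h ≤ Y := by
      refine le_trans (mul_le_mul_of_nonneg_right ?_ (by linarith)) hgY
      exact le_trans (by exact_mod_cast hjm) hmg
    have h2 : Y ≤ 2 ^ j * (2 * (Y / 2 ^ j)) := by
      have h3 := Nat.div_add_mod Y (2 ^ j)
      have h4 := Nat.mod_lt Y (show 0 < 2 ^ j by positivity)
      nlinarith [Nat.mul_le_mul_left (2 ^ j) hB1]
    have h3 : (Y : ℝ) ≤ 2 ^ j * (2 * (Y / 2 ^ j : ℕ)) := by exact_mod_cast h2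
    exact le_of_mul_le_mul_left (h1.trans h3) (by positivity)
  refine Set.mem_biUnion (x := (g.natDegree, j)) ?_ ⟨(g, h), ⟨⟨hg, rfl, ?_⟩, hh, ?_, ?_⟩, rfl⟩
  · simp only [Finset.coe_product, Set.mem_prod, Finset.mem_coe, Finset.mem_filter,
      Finset.mem_range]
    refine ⟨⟨by omega, hg2, by omega⟩, ?_⟩
    have := Nat.log_mono_right (b := 2) hmY
    omega
  · intro i _
    have h1 := abs_coeff_le_intMahler g i
    have h2 : (|g.coeff i| : ℝ) ≤ 2 ^ g.natDegree * 2 ^ (j + 1) :=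
      h1.trans (mul_le_mul_of_nonneg_left hgj (by positivity))
    push_cast
    exact_mod_cast h2
  · simp only
    omega
  · intro i _
    have h1 := abs_coeff_le_intMahler h i
    have h2 : (|h.coeff i| : ℝ) ≤ 2 ^ (n + 1) * (Y / 2 ^ j : ℕ) := by
      refine h1.trans ?_
      rw [pow_succ, mul_assoc]
      refine mul_le_mul ?_ hhj (by linarith) (by positivity)
      exact pow_le_pow_right₀ (by norm_num) (by omega)
    change |h.coeff i| ≤ ((2 ^ (n + 1) * (Y / 2 ^ j) : ℕ) : ℤ)
    rw [← Int.cast_le (R := ℝ), Int.cast_abs, Int.cast_natCast, Nat.cast_mul, Nat.cast_pow,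
      Nat.cast_ofNat]
    exact h2

theorem ncard_nonlinearSplit_le (n H : ℕ) (hH : 1 ≤ H) :
    (nonlinearSplit n H).ncard ≤
      (n + 1) * (Nat.log 2 ((n + 1) * H) + 1) * ((2 ^ (n + 3)) ^ n * ((n + 1) * H) ^ (n - 2)) := by
  classical
  set Y := (n + 1) * H with hY
  have hY1 : 1 ≤ Y := Nat.mul_pos (by omega) hH
  refine (Set.ncard_le_ncard (nonlinearSplit_subset n H) ?_).trans ?_
  · refine Set.Finite.biUnion (Finset.finite_toSet _) fun t _ => Set.Finite.image _ ?_
    exact (monicBox_finite_and_ncard_le _ _).1.prod (monicBox_finite_and_ncard_le _ _).1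
  refine (Finset.set_ncard_biUnion_le _ _).trans ?_
  refine (Finset.sum_le_card_nsmul _ _ ((2 ^ (n + 3)) ^ n * Y ^ (n - 2)) ?_).trans ?_
  · rintro ⟨k, j⟩ ht
    simp only [Finset.mem_product, Finset.mem_filter, Finset.mem_range] at ht
    rw [← hY] at ht
    obtain ⟨⟨hk, hk2, hkn⟩, hj⟩ := ht
    have hjY : 2 ^ j ≤ Y := Nat.pow_le_of_le_log (by omega) (by omega)
    have hB1 : 1 ≤ Y / 2 ^ j := (Nat.one_le_div_iff (by positivity)).2 hjY
    refine (Set.ncard_image_le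
      ((monicBox_finite_and_ncard_le _ _).1.prod (monicBox_finite_and_ncard_le _ _).1)).trans ?_
    rw [Set.ncard_prod]
    refine (Nat.mul_le_mul (monicBox_finite_and_ncard_le _ _).2
      (monicBox_finite_and_ncard_le _ _).2).trans ?_
    simp only
    have h1 : 2 * (2 ^ k * 2 ^ (j + 1)) + 1 ≤ 2 ^ (n + 3) * 2 ^ j := by
      have e1 : 2 * (2 ^ k * 2 ^ (j + 1)) = 2 ^ (k + 2) * 2 ^ j := by ring
      have e2 : 2 ^ (k + 2) * 2 ^ j + 2 ^ (k + 2) * 2 ^ j = 2 ^ (k + 3) * 2 ^ j := by ring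
      have e3 : 1 ≤ 2 ^ (k + 2) * 2 ^ j := Nat.one_le_iff_ne_zero.2 (by positivity)
      have e4 : 2 ^ (k + 3) * 2 ^ j ≤ 2 ^ (n + 3) * 2 ^ j :=
        Nat.mul_le_mul_right _ (Nat.pow_le_pow_right (by norm_num) (by omega))
      omega
    have h2 : 2 * (2 ^ (n + 1) * (Y / 2 ^ j)) + 1 ≤ 2 ^ (n + 3) * (Y / 2 ^ j) := by
      have e3 : 1 ≤ 2 ^ (n + 1) * (Y / 2 ^ j) := Nat.mul_pos (by positivity) hB1
      have e4 : 2 ^ (n + 3) * (Y / 2 ^ j) = 4 * (2 ^ (n + 1) * (Y / 2 ^ j)) := by ring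
      omega
    calc _ ≤ (2 ^ (n + 3) * 2 ^ j) ^ k * (2 ^ (n + 3) * (Y / 2 ^ j)) ^ (n - k) :=
          Nat.mul_le_mul (Nat.pow_le_pow_left h1 _) (Nat.pow_le_pow_left h2 _)
      _ = (2 ^ (n + 3)) ^ (k + (n - k)) * ((2 ^ j) ^ k * (Y / 2 ^ j) ^ (n - k)) := by
          rw [mul_pow, mul_pow, pow_add]; ring
      _ ≤ (2 ^ (n + 3)) ^ n * Y ^ (n - 2) := by
          rw [show k + (n - k) = n by omega]
          refine Nat.mul_le_mul_left _ ?_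
          calc (2 ^ j) ^ k * (Y / 2 ^ j) ^ (n - k)
              ≤ (2 ^ j) ^ (n - k) * (Y / 2 ^ j) ^ (n - k) :=
                Nat.mul_le_mul_right _ (Nat.pow_le_pow_right (by positivity) hkn)
            _ = (2 ^ j * (Y / 2 ^ j)) ^ (n - k) := (mul_pow _ _ _).symm
            _ ≤ Y ^ (n - k) := Nat.pow_le_pow_left (Nat.mul_div_le _ _) _
            _ ≤ Y ^ (n - 2) := Nat.pow_le_pow_right hY1 (by omega)
  · rw [smul_eq_mul, Finset.card_product, Finset.card_range]
    refine Nat.mul_le_mul_right _ (Nat.mul_le_mul_right _ ?_)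
    exact (Finset.card_filter_le _ _).trans (by simp)

/-- The dilate by `t` of the convex body `|x_i| ≤ 1`, `|∑ x_i| ≤ 1`. -/
def slab (m : ℕ) (t : ℝ) : Set (Fin m → ℝ) := {x | (∀ i, |x i| ≤ t) ∧ |∑ i, x i| ≤ t}

theorem slab_volume_ne_top (m : ℕ) (t : ℝ) : volume (slab m t) ≠ ⊤ := by
  have hsub : slab m t ⊆ Set.Icc (fun _ => -t) (fun _ => t) := fun x hx =>
    ⟨fun i => (abs_le.1 (hx.1 i)).1, fun i => (abs_le.1 (hx.1 i)).2⟩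
  exact ((measure_mono hsub).trans_lt isCompact_Icc.measure_lt_top).ne

theorem slab_volume (m : ℕ) {t : ℝ} (ht : 0 < t) :
    (volume (slab m t)).toReal = t ^ m * (volume (slab m 1)).toReal := by
  have h1 : slab m 1 = (fun x => t • x) ⁻¹' slab m t := by
    ext x
    simp only [slab, Set.mem_ofPred_eq, Set.mem_preimage, Pi.smul_apply, smul_eq_mul,
      ← Finset.mul_sum, abs_mul, abs_of_pos ht, mul_le_iff_le_one_right ht]
  rw [h1, Measure.addHaar_preimage_smul _ ht.ne', ENNReal.toReal_mul, ENNReal.toReal_ofReal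
    (abs_nonneg _), Module.finrank_fin_fun, abs_of_pos (by positivity)]
  field_simp

/-- Integer points of the box `|x_i| ≤ H` with `|e + ∑ x_i| ≤ H`. -/
def slabPoints (m : ℕ) (H e : ℤ) : Set (Fin m → ℤ) :=
  {x | (∀ i, |x i| ≤ H) ∧ |∑ i, x i + e| ≤ H}

theorem slabPoints_finite (m : ℕ) (H e : ℤ) : (slabPoints m H e).Finite := by
  refine Set.Finite.subset (Fintype.piFinset fun _ : Fin m => Finset.Icc (-H) H).finite_toSet ?_
  intro x hx
  simp only [Finset.mem_coe, Fintype.mem_piFinset, Finset.mem_Icc]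
  exact fun i => abs_le.1 (hx.1 i)

theorem volume_biUnion_floor {m : ℕ} (s : Finset (Fin m → ℤ)) :
    volume (⋃ x ∈ s, {y : Fin m → ℝ | ∀ i, ⌊y i⌋ = x i}) = s.card := by
  have hcube : ∀ x : Fin m → ℤ, {y : Fin m → ℝ | ∀ i, ⌊y i⌋ = x i} =
      Set.univ.pi fun i => Set.Ico (x i : ℝ) (x i + 1) := by
    intro x
    ext y
    simp [Set.mem_pi, Int.floor_eq_iff]
  rw [measure_biUnion_finset]
  · simp [hcube, volume_pi_pi]
  · intro x _ x' _ hne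
    refine Set.disjoint_left.2 fun y hy hy' => hne (funext fun i => ?_)
    rw [← hy i, hy' i]
  · intro x _
    rw [hcube]
    exact MeasurableSet.univ_pi fun i => measurableSet_Ico

theorem abs_sum_floor_sub_le {m : ℕ} {x : Fin m → ℤ} {y : Fin m → ℝ} (hy : ∀ i, ⌊y i⌋ = x i) :
    (∀ i, |(x i : ℝ) - y i| ≤ 1) ∧ |(∑ i, (x i : ℝ)) - ∑ i, y i| ≤ m := by
  have h1 : ∀ i, |(x i : ℝ) - y i| ≤ 1 := by
    intro i
    rw [← hy i, abs_le]
    constructor <;> linarith [Int.floor_le (y i), Int.lt_floor_add_one (y i)]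
  refine ⟨h1, ?_⟩
  rw [← Finset.sum_sub_distrib]
  refine (Finset.abs_sum_le_sum_abs _ _).trans ?_
  simpa using Finset.sum_le_card_nsmul Finset.univ (fun i => |(x i : ℝ) - y i|) 1 fun i _ => h1 i

theorem ncard_slabPoints_le (m H : ℕ) {e : ℤ} (he : |e| ≤ 1) :
    ((slabPoints m H e).ncard : ℝ) ≤ (volume (slab m (H + (m + 1)))).toReal := by
  have hfin := slabPoints_finite m H e
  have hsub : (⋃ x ∈ hfin.toFinset, {y : Fin m → ℝ | ∀ i, ⌊y i⌋ = x i}) ⊆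
      slab m (H + (m + 1)) := by
    refine Set.iUnion₂_subset fun x hx y hy => ?_
    obtain ⟨h1, h2⟩ := abs_sum_floor_sub_le hy
    obtain ⟨h3, h4⟩ := hfin.mem_toFinset.1 hx
    have h5 : |(∑ i, (x i : ℝ)) + e| ≤ H := by exact_mod_cast h4
    have h6 : |(e : ℝ)| ≤ 1 := by exact_mod_cast he
    refine ⟨fun i => ?_, ?_⟩
    · have h7 : |(x i : ℝ)| ≤ H := by exact_mod_cast h3 i
      have h8 := h1 i
      have h9 : (0 : ℝ) ≤ m := Nat.cast_nonneg _
      rw [abs_le] at *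
      constructor <;> linarith
    · rw [abs_le] at *
      constructor <;> linarith
  have h := measure_mono (μ := volume) hsub
  rw [volume_biUnion_floor, ← Set.ncard_eq_toFinset_card _ hfin] at h
  have := ENNReal.toReal_mono (slab_volume_ne_top _ _) h
  simpa using this

theorem le_ncard_slabPoints (m H : ℕ) {e : ℤ} (he : |e| ≤ 1) :
    (volume (slab m (H - (m + 1)))).toReal ≤ (slabPoints m H e).ncard := by
  have hfin := slabPoints_finite m H e
  have hsub : slab m (H - (m + 1)) ⊆
      (⋃ x ∈ hfin.toFinset, {y : Fin m → ℝ | ∀ i, ⌊y i⌋ = x i}) := by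
    rintro y ⟨h3, h4⟩
    have hy : ∀ i, ⌊y i⌋ = (fun i => ⌊y i⌋) i := fun i => rfl
    obtain ⟨h1, h2⟩ := abs_sum_floor_sub_le hy
    have h6 : |(e : ℝ)| ≤ 1 := by exact_mod_cast he
    refine Set.mem_biUnion (x := fun i => ⌊y i⌋) (hfin.mem_toFinset.2 ⟨fun i => ?_, ?_⟩) hy
    · have h7 := h3 i
      have h8 := h1 i
      have h9 : (0 : ℝ) ≤ m := Nat.cast_nonneg _
      have : |((⌊y i⌋ : ℤ) : ℝ)| ≤ H := by
        rw [abs_le] at *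
        constructor <;> linarith
      exact_mod_cast this
    · have : |(∑ i, ((⌊y i⌋ : ℤ) : ℝ)) + e| ≤ H := by
        rw [abs_le] at *
        constructor <;> linarith
      exact_mod_cast this
  have h := measure_mono (μ := volume) hsub
  rw [volume_biUnion_floor, ← Set.ncard_eq_toFinset_card _ hfin] at h
  have := ENNReal.toReal_mono (by simp) h
  simpa using this

theorem exists_slabPoints_asymptotic (m : ℕ) : ∃ C : ℝ, 0 < C ∧ ∀ H : ℕ, 1 ≤ H → ∀ e : ℤ,
    |e| ≤ 1 →
    |((slabPoints m H e).ncard : ℝ) - (volume (slab m 1)).toReal * H ^ m| ≤ C * H ^ (m - 1) := by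
  set ν := (volume (slab m 1)).toReal with hν
  have hν0 : 0 ≤ ν := ENNReal.toReal_nonneg
  set s : ℝ := m + 1 with hs
  have hs0 : 0 < s := by positivity
  refine ⟨ν * (s * m * (1 + s) ^ (m - 1)) + ν * s + 1, by positivity, fun H hH e he => ?_⟩
  have hH1 : (1 : ℝ) ≤ H := by exact_mod_cast hH
  have hP : (0 : ℝ) ≤ (H : ℝ) ^ (m - 1) := by positivity
  have hup := ncard_slabPoints_le m H he
  have hlow := le_ncard_slabPoints m H he
  rw [slab_volume m (by positivity)] at hup
  have h1 : ((H : ℝ) + s) ^ m - H ^ m ≤ s * m * (1 + s) ^ (m - 1) * H ^ (m - 1) := by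
    refine (le_abs_self _).trans ((abs_pow_sub_pow_le _ _ _).trans ?_)
    rw [add_sub_cancel_left, abs_of_pos hs0, abs_of_pos (by linarith), abs_of_pos (by linarith),
      max_eq_left (by linarith), mul_assoc _ ((1 + s) ^ (m - 1)), ← mul_pow]
    gcongr
    nlinarith
  have h1' := mul_le_mul_of_nonneg_left h1 hν0
  have h3 : 0 ≤ ν * s * (H : ℝ) ^ (m - 1) := by positivity
  have h4 : 0 ≤ ν * (s * m * (1 + s) ^ (m - 1)) * (H : ℝ) ^ (m - 1) := by positivity
  rw [abs_le]
  constructor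
  · rcases lt_or_ge s H with hlt | hge
    · rw [slab_volume m (by linarith)] at hlow
      have h2 : (H : ℝ) ^ m - (H - s) ^ m ≤ s * m * (1 + s) ^ (m - 1) * H ^ (m - 1) := by
        refine (le_abs_self _).trans ((abs_pow_sub_pow_le _ _ _).trans ?_)
        rw [sub_sub_cancel, abs_of_pos hs0, abs_of_pos (by linarith), abs_of_pos (by linarith),
          max_eq_left (by linarith)]
        refine mul_le_mul_of_nonneg_right ?_ hP
        exact le_mul_of_one_le_right (by positivity) (one_le_pow₀ (by linarith))
      have h2' := mul_le_mul_of_nonneg_left h2 hν0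
      nlinarith
    · have h5 : ν * (H : ℝ) ^ m ≤ ν * s * H ^ (m - 1) + H ^ (m - 1) * 0 ∨ m = 0 := by
        rcases Nat.eq_zero_or_pos m with rfl | hm
        · exact Or.inr rfl
        · left
          obtain ⟨l, rfl⟩ : ∃ l, m = l + 1 := ⟨m - 1, by omega⟩
          rw [Nat.add_sub_cancel, pow_succ]
          rw [Nat.add_sub_cancel] at hP
          nlinarith [mul_le_mul_of_nonneg_left hge (mul_nonneg hν0 hP)]
      have h6 : (0 : ℝ) ≤ (slabPoints m H e).ncard := Nat.cast_nonneg _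
      rcases h5 with h5 | h5
      · nlinarith
      · subst h5
        simp at hs hge ⊢
        nlinarith
  · nlinarith

/-- Monic integer polynomials of degree `n` and height at most `H` that vanish at `a`. -/
def monicVanishing (n H : ℕ) (a : ℤ) : Set ℤ[X] :=
  {f | f.Monic ∧ f.natDegree = n ∧ (∀ i, |f.coeff i| ≤ (H : ℤ)) ∧ f.eval a = 0}

theorem exists_monic_coeff_eq (n : ℕ) (c : ℕ → ℤ) :
    ∃ f : ℤ[X], f.Monic ∧ f.natDegree = n ∧ ∀ i < n, f.coeff i = c i := by
  have hdeg : (∑ i ∈ Finset.range n, C (c i) * X ^ i : ℤ[X]).degree < n := by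
    refine (degree_sum_le _ _).trans_lt ((Finset.sup_lt_iff (WithBot.bot_lt_coe n)).2 fun i hi => ?_)
    refine (degree_C_mul_X_pow_le _ _).trans_lt ?_
    exact Nat.cast_lt.2 (Finset.mem_range.1 hi)
  refine ⟨X ^ n + ∑ i ∈ Finset.range n, C (c i) * X ^ i, monic_X_pow_add hdeg, ?_, ?_⟩
  · exact natDegree_eq_of_degree_eq_some
      ((degree_add_eq_left_of_degree_lt (by rwa [degree_X_pow])).trans (degree_X_pow n))
  · intro i hi
    simp [coeff_X_pow, hi.ne, hi]

theorem monic_abs_coeff_le {f : ℤ[X]} (hf : f.Monic) {n H : ℕ} (hn : f.natDegree = n)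
    (hH : 1 ≤ H) (h : ∀ i < n, |f.coeff i| ≤ (H : ℤ)) (i : ℕ) : |f.coeff i| ≤ (H : ℤ) := by
  rcases lt_trichotomy i n with hi | rfl | hi
  · exact h i hi
  · rw [← hn, hf.coeff_natDegree]
    simpa using hH
  · rw [coeff_eq_zero_of_natDegree_lt (hn ▸ hi)]
    simp

theorem monic_eval_eq_sum {f : ℤ[X]} (hf : f.Monic) {m : ℕ} (hn : f.natDegree = m + 1) (a : ℤ) :
    f.eval a = f.coeff 0 + (∑ i : Fin m, a ^ ((i : ℕ) + 1) * f.coeff (i + 1) + a ^ (m + 1)) := by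
  have hlead : f.coeff (m + 1) = 1 := by rw [← hn, hf.coeff_natDegree]
  rw [eval_eq_sum_range, hn, Finset.sum_range_succ, hlead, Finset.sum_range_succ',
    Finset.sum_range]
  simp only [mul_comm (a ^ _)]
  ring

theorem ncard_monicVanishing (m H : ℕ) (hH : 1 ≤ H) {a : ℤ} (ha : |a| = 1) :
    (monicVanishing (m + 1) H a).ncard = (slabPoints m H (a ^ (m + 1))).ncard := by
  have hpow : ∀ k, |a ^ k| = 1 := fun k => by rw [abs_pow, ha, one_pow]
  have hsq : ∀ k : ℕ, a ^ k * a ^ k = 1 := fun k => by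
    rw [← abs_mul_abs_self, hpow, one_mul]
  refine Set.ncard_congr (fun f _ (i : Fin m) => a ^ ((i : ℕ) + 1) * f.coeff (i + 1)) ?_ ?_ ?_
  · rintro f ⟨hf, hn, hH', h0⟩
    refine ⟨fun i => ?_, ?_⟩
    · rw [abs_mul, hpow, one_mul]
      exact hH' _
    · rw [monic_eval_eq_sum hf hn] at h0
      rw [← abs_neg, ← eq_neg_of_add_eq_zero_left h0]
      exact hH' 0
  · rintro f g ⟨hf, hn, -, h0⟩ ⟨hg, hgn, -, hg0⟩ h
    refine monicBox_ext hf hn hg hgn fun i hi => ?_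
    rcases Nat.eq_zero_or_pos i with rfl | hpos
    · rw [monic_eval_eq_sum hf hn] at h0
      rw [monic_eval_eq_sum hg hgn, ← h0] at hg0
      have : ∑ i : Fin m, a ^ ((i : ℕ) + 1) * f.coeff (i + 1) =
          ∑ i : Fin m, a ^ ((i : ℕ) + 1) * g.coeff (i + 1) :=
        Finset.sum_congr rfl fun i _ => congrFun h i
      linarith
    · have h1 := congrFun h ⟨i - 1, by omega⟩
      simp only [Nat.sub_add_cancel hpos] at h1
      refine mul_left_cancel₀ ?_ h1
      intro h2
      simpa [h2] using hsq i
  · rintro x ⟨hx, hs⟩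
    obtain ⟨f, hf, hn, hc⟩ := exists_monic_coeff_eq (m + 1) fun i =>
      if h : 0 < i ∧ i ≤ m then a ^ i * x ⟨i - 1, by omega⟩
      else -(∑ i, x i + a ^ (m + 1))
    have hc0 : f.coeff 0 = -(∑ i, x i + a ^ (m + 1)) := by simp [hc 0 (by omega)]
    have hci : ∀ i : Fin m, f.coeff (i + 1) = a ^ ((i : ℕ) + 1) * x i := by
      intro i
      have hi := i.2
      rw [hc _ (by omega), dif_pos ⟨by omega, by omega⟩]
      rfl
    have hx' : (fun i : Fin m => a ^ ((i : ℕ) + 1) * f.coeff (i + 1)) = x := by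
      funext i
      rw [hci, ← mul_assoc, hsq, one_mul]
    refine ⟨f, ⟨hf, hn, monic_abs_coeff_le hf hn hH fun i hi => ?_, ?_⟩, hx'⟩
    · rcases Nat.eq_zero_or_pos i with rfl | hpos
      · rwa [hc0, abs_neg]
      · have := hci ⟨i - 1, by omega⟩
        simp only [Nat.sub_add_cancel hpos] at this
        rw [this, abs_mul, hpow, one_mul]
        exact hx _
    · rw [monic_eval_eq_sum hf hn, hc0]
      have : ∑ i : Fin m, a ^ ((i : ℕ) + 1) * f.coeff (i + 1) = ∑ i, x i :=
        Finset.sum_congr rfl fun i _ => congrFun hx' i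
      rw [this]
      ring

theorem finrank_splittingField_le {p : ℚ[X]} (hp : p.Separable) :
    Module.finrank ℚ p.SplittingField ≤ p.natDegree.factorial := by
  have : Fact ((p.map (algebraMap ℚ p.SplittingField)).Splits) := ⟨SplittingField.splits p⟩
  rw [← Gal.card_of_separable hp]
  refine (Nat.card_le_card_of_injective _ (Gal.galActionHom_injective p p.SplittingField)).trans ?_
  rw [Nat.card_perm]
  exact Nat.factorial_le (ncard_rootSet_le p p.SplittingField)

theorem isIntegral_coeff_zero_div {K : Type*} [Field K] {h : ℤ[X]} (hh : h.Monic) {z : K}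
    (hz : z ≠ 0) (hroot : aeval z h = 0) : IsIntegral ℤ ((h.coeff 0 : K) / z) := by
  have hi : IsIntegral ℤ z := ⟨h, hh, hroot⟩
  have h1 : (h.coeff 0 : K) / z = -aeval z h.divX := by
    rw [← divX_mul_X_add h, map_add, map_mul, aeval_X, aeval_C, algebraMap_int_eq,
      eq_intCast] at hroot
    field_simp
    linear_combination hroot
  rw [h1]
  refine IsIntegral.neg ?_
  rw [aeval_eq_sum_range]
  exact IsIntegral.sum _ fun i _ => (hi.pow i).smul _

theorem exists_numberField_embedding_roots {h : ℤ[X]} (hh : h.Monic) (hirr : Irreducible h)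
    {ι : Type*} (β : ι → ℂ) (hβ : ∀ i, aeval (β i) h = 0) :
    ∃ (K : Type) (_ : Field K) (_ : NumberField K), Module.finrank ℚ K ≤ h.natDegree.factorial ∧
      ∃ (φ : K →+* ℂ) (ζ : ι → K), ∀ i, φ (ζ i) = β i := by
  set q : ℚ[X] := h.map (Int.castRingHom ℚ) with hq
  have hqirr : Irreducible q := (hh.irreducible_iff_irreducible_map_fraction_map (K := ℚ)).1 hirr
  have hqdeg : q.natDegree = h.natDegree := by rw [hq, hh.natDegree_map]
  let φ₀ : q.SplittingField →ₐ[ℚ] ℂ := IsAlgClosed.lift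
  have hsurj : ∀ i, ∃ z : q.SplittingField, φ₀ z = β i := by
    intro i
    have h1 : β i ∈ q.rootSet ℂ := by
      rw [mem_rootSet]
      refine ⟨hqirr.ne_zero, ?_⟩
      rw [hq, show Int.castRingHom ℚ = algebraMap ℤ ℚ from rfl, aeval_map_algebraMap]
      exact hβ i
    rw [← (SplittingField.splits q).image_rootSet φ₀] at h1
    obtain ⟨z, -, hz⟩ := h1
    exact ⟨z, hz⟩
  choose ζ hζ using hsurj
  exact ⟨q.SplittingField, inferInstance,
    { to_charZero := inferInstance, to_finiteDimensional := inferInstance },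
    hqdeg ▸ finrank_splittingField_le hqirr.separable, φ₀, ζ, hζ⟩

theorem exists_small_root_relation (d : ℕ) :
    ∃ C₀ : ℕ, ∀ (h : ℤ[X]), h.Monic → h.natDegree = d → Irreducible h → h.coeff 0 ≠ 0 →
      ∀ (a : ℤ) (w W : ℕ), 2 ≤ |a| → |a| ≤ 2 ^ w → 1 ≤ w → 1 ≤ W → intMahler h ≤ 2 ^ W →
      ∀ (β : Fin d → ℂ), h.map (Int.castRingHom ℂ) = ∏ i, (X - C (β i)) →
      ∀ (k₀ : ℤ) (k : Fin d → ℤ), (k₀ ≠ 0 ∨ k ≠ 0) → (a : ℂ) ^ k₀ * ∏ i, β i ^ k i = 1 →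
      ∃ (p₀ : ℤ) (p : Fin d → ℤ), p ≠ 0 ∧ (a : ℂ) ^ p₀ * ∏ i, β i ^ p i = 1 ∧
        p₀.natAbs ≤ C₀ * W ^ d ∧ ∀ i, (p i).natAbs ≤ C₀ * (w * W ^ (d - 1)) := by
  classical
  obtain ⟨C₀, hC₀⟩ := exists_small_relation d.factorial (d + 1)
  refine ⟨C₀, ?_⟩
  intro h hh hd hirr h0 a w W ha haw hw hW hM β hβ k₀ k hk hrel
  have hβroot : ∀ i, aeval (β i) h = 0 := by
    intro i
    have h1 : (h.map (Int.castRingHom ℂ)).eval (β i) = 0 := by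
      rw [hβ, eval_prod]
      exact Finset.prod_eq_zero (Finset.mem_univ i) (by simp)
    rwa [eval_map] at h1
  obtain ⟨K, _, _, hfin, φ₀, ζ, hζ⟩ := exists_numberField_embedding_roots hh hirr β hβroot
  rw [hd] at hfin
  have hζroot : ∀ i, aeval (ζ i) h = 0 := by
    intro i
    apply φ₀.injective
    rw [map_zero, ← hβroot i, ← hζ i]
    exact (aeval_algHom_apply φ₀.toIntAlgHom (ζ i) h).symm
  have hne : ∀ i, ζ i ≠ 0 := by
    intro i hi
    have := hζroot i
    rw [hi, ← coeff_zero_eq_aeval_zero', algebraMap_int_eq, eq_intCast] at this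
    exact h0 (by exact_mod_cast this)
  have hφroot : ∀ (φ : K →+* ℂ) i, φ (ζ i) ∈ (h.map (Int.castRingHom ℂ)).roots := by
    intro φ i
    rw [mem_roots (hh.map _).ne_zero, IsRoot.def, eval_map]
    have := congrArg φ (hζroot i)
    rw [aeval_def, hom_eval₂, map_zero] at this
    rwa [show φ.comp (algebraMap ℤ K) = Int.castRingHom ℂ from Subsingleton.elim _ _] at this
  have ha0 : (a : K) ≠ 0 := by
    intro h1
    have : a = 0 := by exact_mod_cast h1
    simp [this] at ha
  obtain ⟨p, hp0, hprel, hpb⟩ := hC₀ K hfin (Option (Fin d)) (by simp)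
    (fun o => o.elim (a : K) ζ) (fun o => o.elim w fun _ => W)
    (fun o => o.elim a.natAbs fun _ => (h.coeff 0).natAbs)
    (by rintro (_ | i) <;> simpa)
    (by
      rintro (_ | i)
      · exact Int.natAbs_pos.2 (by rintro rfl; simp at ha)
      · exact Int.natAbs_pos.2 h0)
    (by
      rintro (_ | i)
      · simp only [Option.elim]
        zify
        exact haw
      · simp only [Option.elim]
        have h1 := norm_coeff_le_choose_mul_mahlerMeasure 0 (h.map (Int.castRingHom ℂ))
        rw [Nat.choose_zero_right, coeff_map] at h1
        simp only [eq_intCast, Complex.norm_intCast, Nat.cast_one, one_mul] at h1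
        zify
        exact_mod_cast h1.trans hM)
    (by
      rintro (_ | i)
      · exact ha0
      · exact hne i)
    (by
      rintro (_ | i)
      · exact isIntegral_algebraMap (R := ℤ) (x := a)
      · exact ⟨h, hh, hζroot i⟩)
    (by
      rintro (_ | i)
      · simp only [Option.elim]
        rcases Int.natAbs_eq a with h1 | h1
        · have : ((a.natAbs : ℕ) : K) = a := by
            rw [← Int.cast_natCast]
            exact_mod_cast (congrArg (Int.cast : ℤ → K) h1.symm)
          rw [this, div_self ha0]
          exact isIntegral_one
        · have : ((a.natAbs : ℕ) : K) = -a := by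
            rw [← Int.cast_natCast]
            exact_mod_cast (congrArg (Int.cast : ℤ → K)
              (show ((a.natAbs : ℕ) : ℤ) = -a by omega))
          rw [this, neg_div, div_self ha0]
          exact isIntegral_one.neg
      · simp only [Option.elim]
        have h2 := isIntegral_coeff_zero_div hh (hne i) (hζroot i)
        rcases Int.natAbs_eq (h.coeff 0) with h1 | h1
        · have : (((h.coeff 0).natAbs : ℕ) : K) = h.coeff 0 := by
            rw [← Int.cast_natCast]
            exact_mod_cast (congrArg (Int.cast : ℤ → K) h1.symm)
          rwa [this]
        · have : (((h.coeff 0).natAbs : ℕ) : K) = -h.coeff 0 := by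
            rw [← Int.cast_natCast]
            exact_mod_cast (congrArg (Int.cast : ℤ → K)
              (show (((h.coeff 0).natAbs : ℕ) : ℤ) = -h.coeff 0 by omega))
          rw [this, neg_div]
          exact h2.neg)
    (by
      rintro φ (_ | i)
      · simp only [Option.elim, map_intCast, Complex.norm_intCast]
        exact_mod_cast haw
      · exact (norm_root_le_intMahler hh (hφroot φ i)).trans hM)
    (by
      rintro φ (_ | i)
      · simp only [Option.elim, map_intCast, Complex.norm_intCast]
        have h1 : (1 : ℝ) ≤ |(a : ℝ)| := by
          have : (1 : ℤ) ≤ |a| := by omega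
          exact_mod_cast this
        exact (inv_le_one_of_one_le₀ h1).trans (one_le_pow₀ (by norm_num))
      · exact (norm_inv_root_le_intMahler hh h0 (hφroot φ i)).trans hM)
    (fun o => o.elim k₀ k)
    (by
      intro h1
      rcases hk with h2 | h2
      · exact h2 (congrFun h1 none)
      · exact h2 (funext fun i => congrFun h1 (some i)))
    (by
      apply φ₀.injective
      rw [map_prod, map_one, Fintype.prod_option]
      simpa [hζ] using hrel)
  have hprel' := congrArg φ₀ hprel
  rw [map_prod, map_one, Fintype.prod_option] at hprel'
  simp only [Option.elim, map_zpow₀, map_intCast, hζ] at hprel'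
  refine ⟨p none, fun i => p (some i), ?_, by simpa using hprel', ?_, ?_⟩
  · intro hps
    apply hp0
    have h1 : ∀ i, p (some i) = 0 := fun i => congrFun hps i
    simp only [h1, zpow_zero, Finset.prod_const_one, mul_one] at hprel'
    have h2 : p none = 0 := by
      have h3 := congrArg norm hprel'
      rw [norm_zpow, norm_one, Complex.norm_intCast] at h3
      have h4 : (1 : ℝ) < |(a : ℝ)| := by
        have : (1 : ℤ) < |a| := by omega
        exact_mod_cast this
      rwa [zpow_eq_one_iff_right₀ (by linarith) h4.ne'] at h3
    funext o
    cases o with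
    | none => exact h2
    | some i => exact h1 i
  · refine (hpb none).trans (Nat.mul_le_mul_left _ (le_of_eq ?_))
    have h1 := Finset.mul_prod_erase Finset.univ (fun j : Option (Fin d) => j.elim w fun _ => W)
      (Finset.mem_univ none)
    rw [Fintype.prod_option] at h1
    simpa [Nat.pos_iff_ne_zero.1 hw] using h1
  · intro i
    refine (hpb (some i)).trans (Nat.mul_le_mul_left _ (le_of_eq ?_))
    have h1 := Finset.mul_prod_erase Finset.univ (fun j : Option (Fin d) => j.elim w fun _ => W)
      (Finset.mem_univ (some i))
    rw [Fintype.prod_option] at h1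
    simp only [Option.elim, Finset.prod_const, Finset.card_univ, Fintype.card_fin] at h1
    refine Nat.eq_of_mul_eq_mul_left hW (h1.trans ?_)
    obtain ⟨e, rfl⟩ : ∃ e, d = e + 1 := ⟨d - 1, by have := i.pos; omega⟩
    rw [Nat.add_sub_cancel]
    ring

theorem eval_ne_zero_of_irreducible {h : ℤ[X]} (hirr : Irreducible h) (hd : 2 ≤ h.natDegree)
    (b : ℤ) : h.eval b ≠ 0 := by
  intro hb
  obtain ⟨g, hg⟩ := dvd_iff_isRoot.2 hb
  rcases hirr.isUnit_or_isUnit hg with hu | hu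
  · exact not_isUnit_X_sub_C b hu
  · have h1 : h.natDegree ≤ 1 := by
      rw [hg]
      refine natDegree_mul_le.trans ?_
      rw [natDegree_X_sub_C, natDegree_eq_zero_of_isUnit hu]
    omega

theorem exists_injective_prod_X_sub_C {h : ℤ[X]} (hh : h.Monic) (hirr : Irreducible h) {d : ℕ}
    (hd : h.natDegree = d) :
    ∃ β : Fin d → ℂ, Function.Injective β ∧
      h.map (Int.castRingHom ℂ) = ∏ i, (X - C (β i)) ∧
      (h.map (Int.castRingHom ℂ)).roots.toFinset = Finset.univ.image β := by
  classical
  set s := (h.map (Int.castRingHom ℂ)).roots with hs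
  have hsep : (h.map (Int.castRingHom ℂ)).Separable := by
    have h1 : (h.map (Int.castRingHom ℚ)).Separable :=
      ((hh.irreducible_iff_irreducible_map_fraction_map (K := ℚ)).1 hirr).separable
    have h2 := h1.map (f := algebraMap ℚ ℂ)
    rwa [map_map, show (algebraMap ℚ ℂ).comp (Int.castRingHom ℚ) = Int.castRingHom ℂ from
      Subsingleton.elim _ _] at h2
  have hnd : s.Nodup := nodup_roots hsep
  have hsplit := IsAlgClosed.splits (h.map (Int.castRingHom ℂ))
  have hcard : s.toFinset.card = d := by
    rw [Multiset.toFinset_card_of_nodup hnd, ← hd, ← hh.natDegree_map (Int.castRingHom ℂ)]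
    exact (splits_iff_card_roots.1 hsplit)
  let e : Fin d ≃ s.toFinset := (s.toFinset.equivFinOfCardEq hcard).symm
  refine ⟨fun i => e i, fun i j hij => e.injective (Subtype.ext hij), ?_, ?_⟩
  · rw [e.prod_comp (fun z : s.toFinset => X - C (z : ℂ)), Finset.prod_coe_sort s.toFinset
      (fun z => X - C z)]
    conv_lhs => rw [hsplit.eq_prod_roots_of_monic (hh.map _)]
    rw [Finset.prod, Multiset.toFinset_val, hnd.dedup]
  · ext z
    simp only [Finset.mem_image, Finset.mem_univ, true_and]
    constructor
    · intro hz
      exact ⟨e.symm ⟨z, hz⟩, by simp⟩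
    · rintro ⟨i, rfl⟩
      exact (e i).2

theorem exists_relation_of_mulDep {h : ℤ[X]} (hh : h.Monic) (hirr : Irreducible h) {d : ℕ}
    (hd : h.natDegree = d) (hd2 : 2 ≤ d) {a : ℤ} (hdep : MulDep (nzRoots ((X - C a) * h))) :
    ∃ β : Fin d → ℂ, (∀ i, β i ≠ 0) ∧ h.map (Int.castRingHom ℂ) = ∏ i, (X - C (β i)) ∧
      ∃ (k₀ : ℤ) (k : Fin d → ℤ), (k₀ ≠ 0 ∨ k ≠ 0) ∧
        ((if a = 0 then 2 else a : ℤ) : ℂ) ^ k₀ * ∏ i, β i ^ k i = 1 := by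
  classical
  obtain ⟨β, hβinj, hβ, hβs⟩ := exists_injective_prod_X_sub_C hh hirr hd
  have hmon := hh.map (Int.castRingHom ℂ)
  have hβb : ∀ (b : ℤ) i, β i ≠ b := by
    intro b i hb
    have h1 : (h.map (Int.castRingHom ℂ)).eval (b : ℂ) = 0 := by
      rw [hβ, eval_prod]
      exact Finset.prod_eq_zero (Finset.mem_univ i) (by simp [hb])
    rw [eval_intCast_map] at h1
    exact eval_ne_zero_of_irreducible hirr (hd ▸ hd2) b
      (by simpa using h1)
  have hβ0 : ∀ i, β i ≠ 0 := fun i => by simpa using hβb 0 i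
  have hroots : nzRoots ((X - C a) * h) =
      if a = 0 then Finset.univ.image β else insert (a : ℂ) (Finset.univ.image β) := by
    have h1 : ((X - C a) * h).map (Int.castRingHom ℂ) =
        (X - C (a : ℂ)) * h.map (Int.castRingHom ℂ) := by simp
    rw [nzRoots, h1, roots_mul ((monic_X_sub_C _).mul hmon).ne_zero, roots_X_sub_C,
      Multiset.toFinset_add, Multiset.toFinset_singleton, hβs]
    ext z
    split_ifs with ha
    · simp only [ha, Int.cast_zero, Finset.mem_filter, Finset.mem_union, Finset.mem_singleton,
        Finset.mem_image, Finset.mem_univ, true_and]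
      constructor
      · rintro ⟨h2 | h2, h3⟩
        · exact absurd h2 h3
        · exact h2
      · rintro ⟨i, rfl⟩
        exact ⟨Or.inr ⟨i, rfl⟩, hβ0 i⟩
    · simp only [Finset.mem_filter, Finset.mem_union, Finset.mem_singleton, Finset.mem_insert,
        Finset.mem_image, Finset.mem_univ, true_and]
      constructor
      · rintro ⟨h2, -⟩
        exact h2
      · rintro (rfl | ⟨i, rfl⟩)
        · exact ⟨Or.inl rfl, by exact_mod_cast ha⟩
        · exact ⟨Or.inr ⟨i, rfl⟩, hβ0 i⟩
  obtain ⟨k, ⟨z, hz, hkz⟩, hk⟩ := hdep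
  rw [hroots] at hz hk
  refine ⟨β, hβ0, hβ, if a = 0 then 0 else k a, fun i => k (β i), ?_, ?_⟩
  · split_ifs at hz ⊢ with ha
    · obtain ⟨i, -, rfl⟩ := Finset.mem_image.1 hz
      exact Or.inr fun h2 => hkz (congrFun h2 i)
    · rcases Finset.mem_insert.1 hz with rfl | hz
      · exact Or.inl hkz
      · obtain ⟨i, -, rfl⟩ := Finset.mem_image.1 hz
        exact Or.inr fun h2 => hkz (congrFun h2 i)
  · split_ifs at hk ⊢ with ha
    · rwa [Finset.prod_image hβinj.injOn, ← one_mul (∏ i, _)] at hk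
    · rwa [Finset.prod_insert, Finset.prod_image hβinj.injOn] at hk
      simpa using hβb a

theorem coeff_zero_ne_zero_of_irreducible {h : ℤ[X]} (hirr : Irreducible h)
    (hd : 2 ≤ h.natDegree) : h.coeff 0 ≠ 0 := by
  rw [coeff_zero_eq_eval_zero]
  exact eval_ne_zero_of_irreducible hirr hd 0

theorem exists_ncard_dependent_cofactor_le (d : ℕ) (hd : 2 ≤ d) :
    ∃ C₁ : ℕ, ∀ (a : ℤ) (w W B : ℕ), |a| ≠ 1 → |if a = 0 then 2 else a| ≤ 2 ^ w → 1 ≤ w → 1 ≤ W →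
      {h ∈ monicBox d B | Irreducible h ∧ intMahler h ≤ 2 ^ W ∧
        MulDep (nzRoots ((X - C a) * h))}.ncard ≤
      C₁ * (W ^ (d ^ 2 + d - 1) * w ^ (d + 1) * (2 * B + 1) ^ (d - 1)) := by
  classical
  obtain ⟨C₀, hC₀⟩ := exists_small_root_relation d
  refine ⟨(2 * C₀ + 1) * (2 * C₀ + 1) ^ d * (d.factorial * (d * C₀)), ?_⟩
  intro a w W B ha haw hw hW
  set a' : ℤ := if a = 0 then 2 else a with ha'
  have ha2 : 2 ≤ |a'| := by
    rw [ha']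
    split_ifs with h0
    · simp
    · have := abs_pos.2 h0
      omega
  have ha'0 : (a' : ℂ) ≠ 0 := by
    have : a' ≠ 0 := by rintro h0; simp [h0] at ha2
    exact_mod_cast this
  set P₀ : ℕ := C₀ * W ^ d with hP₀
  set P : ℕ := C₀ * (w * W ^ (d - 1)) with hP
  let rel : ℤ × (Fin d → ℤ) → Set ℤ[X] := fun t =>
    {h ∈ monicBox d B | ∃ β : Fin d → ℂ, (∀ i, β i ≠ 0) ∧
      h.map (Int.castRingHom ℂ) = ∏ i, (X - C (β i)) ∧
      (a' : ℂ) ^ t.1 * ∏ i, β i ^ t.2 i = 1}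
  let T : Finset (ℤ × (Fin d → ℤ)) :=
    (Finset.Icc (-P₀ : ℤ) P₀ ×ˢ Fintype.piFinset fun _ => Finset.Icc (-P : ℤ) P).filter
      fun t => t.2 ≠ 0
  have hsub : {h ∈ monicBox d B | Irreducible h ∧ intMahler h ≤ 2 ^ W ∧
      MulDep (nzRoots ((X - C a) * h))} ⊆ ⋃ t ∈ T, rel t := by
    rintro h ⟨hbox, hirr, hM, hdep⟩
    obtain ⟨β, hβ0, hβ, k₀, k, hk, hrel⟩ := exists_relation_of_mulDep hbox.1 hirr hbox.2.1 hd hdep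
    obtain ⟨p₀, p, hp, hrel', hp₀, hpb⟩ := hC₀ h hbox.1 hbox.2.1 hirr
      (coeff_zero_ne_zero_of_irreducible hirr (hbox.2.1 ▸ hd)) a' w W ha2 haw hw hW hM β hβ k₀ k hk
      hrel
    refine Set.mem_biUnion (x := (p₀, p)) ?_ ⟨hbox, β, hβ0, hβ, hrel'⟩
    simp only [T, Finset.coe_filter, Finset.mem_product, Finset.mem_Icc, Fintype.mem_piFinset,
      Set.mem_ofPred_eq]
    refine ⟨⟨by omega, fun i => ?_⟩, hp⟩
    have := hpb i
    omega
  have hfin : (⋃ t ∈ T, rel t).Finite :=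
    Set.Finite.biUnion T.finite_toSet fun t _ =>
      (monicBox_finite_and_ncard_le d B).1.subset fun h hh => hh.1
  have hone : ∀ t ∈ T, (rel t).ncard ≤ d.factorial * (d * P) * (2 * B + 1) ^ (d - 1) := by
    intro t ht
    simp only [T, Finset.mem_filter, Finset.mem_product, Finset.mem_Icc,
      Fintype.mem_piFinset] at ht
    refine (ncard_monicBox_relation_le (by omega) B _ (zpow_ne_zero _ ha'0) t.2 ht.2).trans ?_
    refine Nat.mul_le_mul_right _ (Nat.mul_le_mul_left _ ?_)
    calc ∑ i, (t.2 i).natAbs ≤ ∑ _i : Fin d, P := Finset.sum_le_sum fun i _ => by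
          have := ht.1.2 i
          omega
      _ = d * P := by simp
  have hT : T.card ≤ (2 * P₀ + 1) * (2 * P + 1) ^ d := by
    refine (Finset.card_filter_le _ _).trans (le_of_eq ?_)
    rw [Finset.card_product, Fintype.card_piFinset_const, Int.card_Icc, Int.card_Icc]
    congr 2 <;> omega
  have hWd : 1 ≤ W ^ d := Nat.one_le_pow _ _ hW
  have hwW : 1 ≤ w * W ^ (d - 1) := Nat.mul_pos hw (Nat.pow_pos hW)
  calc _ ≤ (⋃ t ∈ T, rel t).ncard := Set.ncard_le_ncard hsub hfin
    _ ≤ ∑ t ∈ T, (rel t).ncard := Finset.set_ncard_biUnion_le _ _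
    _ ≤ T.card * (d.factorial * (d * P) * (2 * B + 1) ^ (d - 1)) := by
      rw [← smul_eq_mul]
      exact Finset.sum_le_card_nsmul _ _ _ hone
    _ ≤ ((2 * P₀ + 1) * (2 * P + 1) ^ d) * (d.factorial * (d * P) * (2 * B + 1) ^ (d - 1)) :=
      Nat.mul_le_mul_right _ hT
    _ ≤ (((2 * C₀ + 1) * W ^ d) * ((2 * C₀ + 1) * (w * W ^ (d - 1))) ^ d) *
        (d.factorial * (d * P) * (2 * B + 1) ^ (d - 1)) := by
      refine Nat.mul_le_mul_right _ (Nat.mul_le_mul ?_ (Nat.pow_le_pow_left ?_ _))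
      · rw [hP₀]; nlinarith
      · rw [hP]; nlinarith
    _ = (2 * C₀ + 1) * (2 * C₀ + 1) ^ d * (d.factorial * (d * C₀)) *
        ((W ^ d * (W ^ (d - 1)) ^ (d + 1)) * w ^ (d + 1) * (2 * B + 1) ^ (d - 1)) := by
      rw [hP, mul_pow (2 * C₀ + 1), mul_pow w]; ring
    _ = _ := by
      obtain ⟨e, rfl⟩ : ∃ e, d = e + 1 := ⟨d - 1, by omega⟩
      congr 3
      rw [← pow_mul, ← pow_add]
      congr 1
      simp only [Nat.add_sub_cancel]
      rw [show (e + 1) ^ 2 + (e + 1) - 1 = (e + 1) ^ 2 + e by omega]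
      ring

theorem summable_max_one_natAbs_rpow :
    Summable fun a : ℤ => ((max 1 a.natAbs : ℕ) : ℝ) ^ (-(3 / 2) : ℝ) := by
  have h : Summable fun n : ℕ => ((max 1 n : ℕ) : ℝ) ^ (-(3 / 2) : ℝ) := by
    rw [← summable_nat_add_iff 1]
    have h1 := (summable_nat_add_iff 1).2
      (Real.summable_nat_rpow (p := -(3 / 2)).2 (by norm_num))
    refine h1.congr fun n => ?_
    rw [max_eq_right (by omega)]
  refine Summable.of_nat_of_neg ?_ ?_
  · simpa using h
  · simpa using h

theorem sq_add_two_le (l : ℕ) : (l + 2) ^ 2 ≤ 16 * 2 ^ l := by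
  induction l with
  | zero => norm_num
  | succ l ih =>
    rcases Nat.eq_zero_or_pos l with rfl | hl
    · norm_num
    · rw [pow_succ 2 l]
      nlinarith

theorem log_add_two_mul_div_le {u Y e : ℕ} (hu : 1 ≤ u) (he : 2 ≤ e) :
    ((Nat.log 2 u + 2 : ℕ) : ℝ) * ((Y : ℝ) / u) ^ e ≤ 4 * Y ^ e * (u : ℝ) ^ (-(3 / 2) : ℝ) := by
  have hu' : (1 : ℝ) ≤ u := by exact_mod_cast hu
  have hu0 : (0 : ℝ) < u := by linarith
  have h1 : ((Nat.log 2 u + 2 : ℕ) : ℝ) ≤ 4 * (u : ℝ) ^ (1 / 2 : ℝ) := by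
    rw [← Real.sqrt_eq_rpow]
    refine abs_le_of_sq_le_sq' ?_ (by positivity) |>.2
    rw [mul_pow, Real.sq_sqrt hu0.le]
    have h2 := (sq_add_two_le (Nat.log 2 u)).trans
      (Nat.mul_le_mul_left 16 (Nat.pow_log_le_self 2 (by omega)))
    norm_num
    exact_mod_cast h2
  have h2 : ((Y : ℝ) / u) ^ e ≤ Y ^ e * (u : ℝ) ^ (-2 : ℝ) := by
    rw [div_pow, Real.rpow_neg hu0.le, div_eq_mul_inv]
    refine mul_le_mul_of_nonneg_left ?_ (by positivity)
    refine inv_anti₀ (by positivity) ?_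
    rw [show (2 : ℝ) = ((2 : ℕ) : ℝ) by norm_num, Real.rpow_natCast]
    exact pow_le_pow_right₀ hu' he
  calc _ ≤ (4 * (u : ℝ) ^ (1 / 2 : ℝ)) * (Y ^ e * (u : ℝ) ^ (-2 : ℝ)) :=
        mul_le_mul h1 h2 (by positivity) (by positivity)
    _ = 4 * Y ^ e * ((u : ℝ) ^ (1 / 2 : ℝ) * (u : ℝ) ^ (-2 : ℝ)) := by ring
    _ = _ := by
      rw [← Real.rpow_add hu0]
      norm_num

theorem intMahler_X_sub_C (a : ℤ) : intMahler (X - C a) = (max 1 a.natAbs : ℕ) := by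
  rw [intMahler, Polynomial.map_sub, map_X, map_C, mahlerMeasure_X_sub_C, eq_intCast]
  push_cast
  rw [Complex.norm_intCast, Nat.cast_natAbs, Int.cast_abs]

/-- Integer polynomials of height at most `H` of the form `(X - a) * h` with `a ≠ ±1` and `h` monic
irreducible of degree `d`, whose nonzero roots are multiplicatively dependent. -/
def linearSplit (d H : ℕ) : Set ℤ[X] :=
  {f | (∀ i, |f.coeff i| ≤ (H : ℤ)) ∧ ∃ (a : ℤ) (h : ℤ[X]), |a| ≠ 1 ∧ h.Monic ∧
    h.natDegree = d ∧ Irreducible h ∧ f = (X - C a) * h ∧ MulDep (nzRoots f)}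

theorem exists_ncard_linearSplit_le (d : ℕ) (hd : 3 ≤ d) :
    ∃ C₂ : ℝ, 0 ≤ C₂ ∧ ∀ H : ℕ, 1 ≤ H → ((linearSplit d H).ncard : ℝ) ≤
      C₂ * ((Nat.log 2 ((d + 2) * H) + 1 : ℕ) : ℝ) ^ (d ^ 2 + 2 * d - 1) *
        (((d + 2) * H : ℕ) : ℝ) ^ (d - 1) := by
  classical
  obtain ⟨C₁, hC₁⟩ := exists_ncard_dependent_cofactor_le d (by omega)
  set S : ℝ := ∑' a : ℤ, ((max 1 a.natAbs : ℕ) : ℝ) ^ (-(3 / 2) : ℝ) with hS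
  refine ⟨C₁ * 2 ^ d * (2 ^ (d + 3)) ^ (d - 1) * 4 * S, ?_, ?_⟩
  · have : 0 ≤ S := tsum_nonneg fun a => by positivity
    positivity
  intro H hH
  set Y : ℕ := (d + 2) * H with hY
  set W : ℕ := Nat.log 2 Y + 1 with hW
  have hYpos : 1 ≤ Y := Nat.mul_pos (by omega) hH
  let u : ℤ → ℕ := fun a => max 1 a.natAbs
  let w : ℤ → ℕ := fun a => Nat.log 2 (u a) + 2
  let B : ℤ → ℕ := fun a => 2 ^ (d + 1) * (Y / u a)
  have hu : ∀ a, 1 ≤ u a := fun a => le_max_left _ _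
  let G : ℤ → Set ℤ[X] := fun a => {h ∈ monicBox d (B a) | Irreducible h ∧ intMahler h ≤ 2 ^ W ∧
    MulDep (nzRoots ((X - C a) * h))}
  have hGfin : ∀ a, (G a).Finite := fun a =>
    (monicBox_finite_and_ncard_le d (B a)).1.subset fun h hh => hh.1
  let T : Finset ℤ := (Finset.Icc (-Y : ℤ) Y).filter fun a => |a| ≠ 1
  have hTu : ∀ a ∈ T, u a ≤ Y := by
    intro a ha
    simp only [T, Finset.mem_filter, Finset.mem_Icc] at ha
    simp only [u]
    omega
  have hsub : linearSplit d H ⊆ ⋃ a ∈ T, (fun h => (X - C a) * h) '' G a := by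
    rintro f ⟨hf, a, h, ha, hh, hhd, hirr, rfl, hdep⟩
    have h1 := intMahler_le_of_abs_coeff_le hf
    rw [intMahler_mul, intMahler_X_sub_C, (monic_X_sub_C a).natDegree_mul hh, natDegree_X_sub_C,
      hhd, show (1 + d + 1 : ℕ) = d + 2 by ring, ← Nat.cast_mul, ← hY] at h1
    change ((u a : ℕ) : ℝ) * _ ≤ _ at h1
    have hM1 := one_le_intMahler hh
    have hu' : (1 : ℝ) ≤ u a := by exact_mod_cast hu a
    have huY : u a ≤ Y := by
      have : (u a : ℝ) ≤ Y := by nlinarith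
      exact_mod_cast this
    have hMY : intMahler h ≤ Y := by nlinarith
    have hq : 1 ≤ Y / u a := Nat.div_pos huY (hu a)
    have hMq : intMahler h ≤ 2 * (Y / u a : ℕ) := by
      have h2 : Y < u a * (Y / u a + 1) := by
        rw [mul_comm]
        exact Nat.lt_mul_of_div_lt (Nat.lt_succ_self _) (hu a)
      have h3 : (Y : ℝ) < u a * ((Y / u a : ℕ) + 1) := by exact_mod_cast h2
      have h4 : intMahler h < (Y / u a : ℕ) + 1 :=
        lt_of_mul_lt_mul_left (h1.trans_lt h3) (by linarith)
      have h5 : (1 : ℝ) ≤ (Y / u a : ℕ) := by exact_mod_cast hq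
      linarith
    refine Set.mem_biUnion (x := a) ?_ ⟨h, ⟨⟨hh, hhd, fun i _ => ?_⟩, hirr, ?_, hdep⟩, rfl⟩
    · simp only [T, Finset.coe_filter, Finset.mem_Icc, Set.mem_ofPred_eq]
      refine ⟨?_, ha⟩
      have : a.natAbs ≤ u a := le_max_right _ _
      omega
    · have h2 := abs_coeff_le_intMahler h i
      rw [hhd] at h2
      have h3 : (|h.coeff i| : ℝ) ≤ (B a : ℕ) := by
        refine h2.trans ?_
        simp only [B]
        push_cast
        rw [pow_succ, mul_assoc]
        exact mul_le_mul_of_nonneg_left (by exact_mod_cast hMq) (by positivity)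
      exact_mod_cast h3
    · refine hMY.trans ?_
      exact_mod_cast (Nat.lt_pow_succ_log_self (by norm_num) Y).le
  have hone : ∀ a ∈ T, ((G a).ncard : ℝ) ≤ C₁ * 2 ^ d * (2 ^ (d + 3)) ^ (d - 1) * 4 *
      (W : ℝ) ^ (d ^ 2 + 2 * d - 1) * (Y : ℝ) ^ (d - 1) * (u a : ℝ) ^ (-(3 / 2) : ℝ) := by
    intro a ha
    have huY := hTu a ha
    have ha1 : |a| ≠ 1 := (Finset.mem_filter.1 ha).2
    have hpow : u a ≤ 2 ^ (Nat.log 2 (u a) + 1) := (Nat.lt_pow_succ_log_self (by norm_num) _).le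
    have haw : |if a = 0 then 2 else a| ≤ 2 ^ w a := by
      have h2 : max 2 (u a) ≤ 2 ^ w a := by
        simp only [w]
        rw [pow_succ]
        have := hu a
        omega
      have h3 : ((max 2 (u a) : ℕ) : ℤ) ≤ 2 ^ w a := by exact_mod_cast h2
      refine le_trans ?_ h3
      have : a.natAbs ≤ u a := le_max_right _ _
      split_ifs
      · simp
      · rw [Int.abs_eq_natAbs]
        exact_mod_cast this.trans (le_max_right _ _)
    have h1 : (G a).ncard ≤ _ := hC₁ a (w a) W (B a) ha1 haw (by simp only [w]; omega) (by omega)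
    have hwW : w a ≤ 2 * W := by
      have := Nat.log_mono_right (b := 2) huY
      simp only [w]
      omega
    have hq : 1 ≤ Y / u a := Nat.div_pos huY (hu a)
    have hB : ((2 * B a + 1 : ℕ) : ℝ) ≤ 2 ^ (d + 3) * ((Y : ℝ) / u a) := by
      have h2 : 2 * B a + 1 ≤ 2 ^ (d + 3) * (Y / u a) := by
        have : 1 ≤ 2 ^ (d + 1) * (Y / u a) := Nat.mul_pos (by positivity) hq
        simp only [B]
        rw [show d + 3 = d + 1 + 2 by ring, pow_add 2 (d + 1) 2]
        nlinarith
      have h3 : ((Y / u a : ℕ) : ℝ) ≤ (Y : ℝ) / u a := Nat.cast_div_le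
      calc ((2 * B a + 1 : ℕ) : ℝ) ≤ ((2 ^ (d + 3) * (Y / u a) : ℕ) : ℝ) := by exact_mod_cast h2
        _ = 2 ^ (d + 3) * ((Y / u a : ℕ) : ℝ) := by push_cast; ring
        _ ≤ _ := mul_le_mul_of_nonneg_left h3 (by positivity)
    have hw : ((w a : ℕ) : ℝ) ^ (d + 1) ≤ 2 ^ d * (W : ℝ) ^ d * w a := by
      rw [pow_succ, ← mul_pow]
      refine mul_le_mul_of_nonneg_right (pow_le_pow_left₀ (by positivity) ?_ _) (by positivity)
      exact_mod_cast hwW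
    calc ((G a).ncard : ℝ)
        ≤ C₁ * ((W : ℝ) ^ (d ^ 2 + d - 1) * (w a : ℝ) ^ (d + 1) *
            ((2 * B a + 1 : ℕ) : ℝ) ^ (d - 1)) := by exact_mod_cast h1
      _ ≤ C₁ * ((W : ℝ) ^ (d ^ 2 + d - 1) * (2 ^ d * (W : ℝ) ^ d * w a) *
            (2 ^ (d + 3) * ((Y : ℝ) / u a)) ^ (d - 1)) := by gcongr
      _ = C₁ * 2 ^ d * (2 ^ (d + 3)) ^ (d - 1) * ((W : ℝ) ^ (d ^ 2 + d - 1) * (W : ℝ) ^ d) *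
            (w a * ((Y : ℝ) / u a) ^ (d - 1)) := by rw [mul_pow]; ring
      _ ≤ C₁ * 2 ^ d * (2 ^ (d + 3)) ^ (d - 1) * ((W : ℝ) ^ (d ^ 2 + d - 1) * (W : ℝ) ^ d) *
            (4 * Y ^ (d - 1) * (u a : ℝ) ^ (-(3 / 2) : ℝ)) :=
        mul_le_mul_of_nonneg_left (log_add_two_mul_div_le (hu a) (by omega)) (by positivity)
      _ = _ := by
        rw [← pow_add, show d ^ 2 + d - 1 + d = d ^ 2 + 2 * d - 1 by omega]
        ring
  have hcard : (linearSplit d H).ncard ≤ ∑ a ∈ T, (G a).ncard := by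
    refine (Set.ncard_le_ncard hsub (Set.Finite.biUnion T.finite_toSet fun a _ =>
      (hGfin a).image _)).trans ?_
    exact (Finset.set_ncard_biUnion_le _ _).trans
      (Finset.sum_le_sum fun a _ => Set.ncard_image_le (hGfin a))
  calc ((linearSplit d H).ncard : ℝ) ≤ ∑ a ∈ T, ((G a).ncard : ℝ) := by exact_mod_cast hcard
    _ ≤ ∑ a ∈ T, C₁ * 2 ^ d * (2 ^ (d + 3)) ^ (d - 1) * 4 * (W : ℝ) ^ (d ^ 2 + 2 * d - 1) *
        (Y : ℝ) ^ (d - 1) * (u a : ℝ) ^ (-(3 / 2) : ℝ) := Finset.sum_le_sum hone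
    _ = C₁ * 2 ^ d * (2 ^ (d + 3)) ^ (d - 1) * 4 * (W : ℝ) ^ (d ^ 2 + 2 * d - 1) *
        (Y : ℝ) ^ (d - 1) * ∑ a ∈ T, (u a : ℝ) ^ (-(3 / 2) : ℝ) := by rw [Finset.mul_sum]
    _ ≤ C₁ * 2 ^ d * (2 ^ (d + 3)) ^ (d - 1) * 4 * (W : ℝ) ^ (d ^ 2 + 2 * d - 1) *
        (Y : ℝ) ^ (d - 1) * S := by
      refine mul_le_mul_of_nonneg_left ?_ (by positivity)
      exact summable_max_one_natAbs_rpow.sum_le_tsum T fun a _ => by positivity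
    _ = _ := by ring

theorem mem_nonlinearSplit {n H : ℕ} {f g h : ℤ[X]} (hf : f.Monic) (hfn : f.natDegree = n)
    (hH : ∀ i, |f.coeff i| ≤ (H : ℤ)) (hg : g.Monic) (hh : h.Monic) (hgd : 2 ≤ g.natDegree)
    (hhd : 2 ≤ h.natDegree) (hfg : f = g * h) : f ∈ nonlinearSplit n H := by
  rcases le_total g.natDegree h.natDegree with hle | hle
  · exact ⟨hf, hfn, hH, g, h, hg, hh, hgd, hle, hfg⟩
  · exact ⟨hf, hfn, hH, h, g, hh, hg, hhd, hle, by rw [hfg, mul_comm]⟩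

theorem monicVanishing_subset_Rset {n H : ℕ} (hn : 2 ≤ n) {a : ℤ} (ha : |a| = 1) :
    monicVanishing n H a ⊆ Rset n H := by
  classical
  rintro f ⟨hf, hfn, hH, hfa⟩
  refine ⟨hf, hfn, hH, fun hirr => eval_ne_zero_of_irreducible hirr (hfn ▸ hn) a hfa, hfn ▸ hn,
    fun z => if z = a then 2 else 0, ⟨a, ?_, by simp⟩, Finset.prod_eq_one fun z _ => ?_⟩
  · have ha0 : a ≠ 0 := by rintro rfl; simp at ha
    rw [nzRoots, Finset.mem_filter, Multiset.mem_toFinset, mem_roots (hf.map _).ne_zero, IsRoot.def,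
      eval_intCast_map, Int.cast_id, hfa]
    exact ⟨by simp, by exact_mod_cast ha0⟩
  · have ha2 : a ^ 2 = 1 := by rw [← sq_abs, ha, one_pow]
    dsimp only
    split_ifs with hz
    · rw [hz]
      exact_mod_cast ha2
    · exact zpow_zero z

theorem monicVanishing_inter_subset {n H : ℕ} (hn : 4 ≤ n) :
    monicVanishing n H 1 ∩ monicVanishing n H (-1) ⊆ nonlinearSplit n H := by
  rintro f ⟨⟨hf, hfn, hH, hf1⟩, -, -, -, hf2⟩
  obtain ⟨g, rfl⟩ := dvd_iff_isRoot.2 hf1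
  rw [eval_mul, eval_sub, eval_X, eval_C] at hf2
  have hg2 : g.eval (-1) = 0 := by omega
  obtain ⟨r, rfl⟩ := dvd_iff_isRoot.2 hg2
  have hm : ((X - C 1) * (X - C (-1)) : ℤ[X]).Monic :=
    (monic_X_sub_C 1).mul (monic_X_sub_C (-1))
  have hd : ((X - C 1) * (X - C (-1)) : ℤ[X]).natDegree = 2 := by
    rw [(monic_X_sub_C 1).natDegree_mul (monic_X_sub_C (-1)), natDegree_X_sub_C, natDegree_X_sub_C]
  have hr : r.Monic := hm.of_mul_monic_left (by rwa [mul_assoc])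
  refine mem_nonlinearSplit hf hfn hH hm hr hd.ge ?_ (mul_assoc _ _ _).symm
  rw [← mul_assoc, hm.natDegree_mul hr, hd] at hfn
  omega

theorem exists_monic_factor_of_not_irreducible {f : ℤ[X]} (hf : f.Monic) (hd : 1 ≤ f.natDegree)
    (hirr : ¬ Irreducible f) :
    ∃ g h : ℤ[X], g.Monic ∧ h.Monic ∧ f = g * h ∧ 1 ≤ g.natDegree ∧
      g.natDegree ≤ h.natDegree := by
  rw [hf.irreducible_iff_natDegree'] at hirr
  push Not at hirr
  obtain ⟨h, g, hh, hg, rfl, hmem⟩ := hirr (by rintro rfl; simp at hd)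
  rw [hh.natDegree_mul hg, Finset.mem_Ioc] at hmem
  exact ⟨g, h, hg, hh, mul_comm _ _, hmem.1, by omega⟩

theorem Rset_subset {n H : ℕ} (hn : 4 ≤ n) :
    Rset n H ⊆ (monicVanishing n H 1 ∪ monicVanishing n H (-1)) ∪
      (nonlinearSplit n H ∪ linearSplit (n - 1) H) := by
  rintro f ⟨hf, hfn, hH, hirr, -, hdep⟩
  obtain ⟨g, h, hg, hh, hfg, hgd, hgh⟩ :=
    exists_monic_factor_of_not_irreducible hf (by omega) hirr
  have hdeg : g.natDegree + h.natDegree = n := by rw [← hg.natDegree_mul hh, ← hfg, hfn]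
  by_cases hg2 : 2 ≤ g.natDegree
  · exact Or.inr (Or.inl ⟨hf, hfn, hH, g, h, hg, hh, hg2, hgh, hfg⟩)
  have hg1 : g.natDegree = 1 := by omega
  obtain ⟨a, ha⟩ : ∃ a : ℤ, g = X - C a := ⟨-g.coeff 0, by
    rw [map_neg, sub_neg_eq_add]
    exact hg.eq_X_add_C hg1⟩
  by_cases hhirr : Irreducible h
  · by_cases ha1 : |a| = 1
    · have hroot : f.eval a = 0 := by simp [hfg, ha]
      rcases eq_or_eq_neg_of_abs_eq ha1 with rfl | rfl
      · exact Or.inl (Or.inl ⟨hf, hfn, hH, hroot⟩)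
      · exact Or.inl (Or.inr ⟨hf, hfn, hH, hroot⟩)
    · exact Or.inr (Or.inr ⟨hH, a, h, ha1, hh, by omega, hhirr, by rw [hfg, ha], hdep⟩)
  · obtain ⟨p, q, hp, hq, hpq, hpd, hpq'⟩ :=
      exists_monic_factor_of_not_irreducible hh (by omega) hhirr
    have hdeg' : p.natDegree + q.natDegree = h.natDegree := by rw [hpq, hp.natDegree_mul hq]
    refine Or.inr (Or.inl (mem_nonlinearSplit hf hfn hH (hg.mul hp) hq ?_ (by omega) ?_))
    · rw [hg.natDegree_mul hp]
      omega
    · rw [hfg, hpq, mul_assoc]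

theorem finite_of_monic_of_abs_coeff_le {n H : ℕ} {s : Set ℤ[X]}
    (hs : ∀ f ∈ s, f.Monic ∧ f.natDegree = n ∧ ∀ i, |f.coeff i| ≤ (H : ℤ)) : s.Finite :=
  (monicBox_finite_and_ncard_le n H).1.subset fun f hf =>
    ⟨(hs f hf).1, (hs f hf).2.1, fun i _ => (hs f hf).2.2 i⟩

theorem abs_ncard_Rset_sub_le {n H : ℕ} (hn : 4 ≤ n) :
    |((Rset n H).ncard : ℝ) - (monicVanishing n H 1).ncard - (monicVanishing n H (-1)).ncard| ≤
      (nonlinearSplit n H).ncard + (linearSplit (n - 1) H).ncard := by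
  have hR : (Rset n H).Finite :=
    finite_of_monic_of_abs_coeff_le (n := n) (H := H) fun f hf => ⟨hf.1, hf.2.1, hf.2.2.1⟩
  have hF : ∀ a, (monicVanishing n H a).Finite := fun a =>
    finite_of_monic_of_abs_coeff_le (n := n) (H := H) fun f hf => ⟨hf.1, hf.2.1, hf.2.2.1⟩
  have hS : (nonlinearSplit n H).Finite :=
    finite_of_monic_of_abs_coeff_le (n := n) (H := H) fun f hf => ⟨hf.1, hf.2.1, hf.2.2.1⟩
  have hL : (linearSplit (n - 1) H).Finite := by
    refine finite_of_monic_of_abs_coeff_le (n := n) (H := H) ?_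
    rintro f ⟨hf, a, h, -, hh, hd, -, rfl, -⟩
    refine ⟨(monic_X_sub_C a).mul hh, ?_, hf⟩
    rw [(monic_X_sub_C a).natDegree_mul hh, natDegree_X_sub_C, hd]
    omega
  have h1 := (Set.ncard_le_ncard (Rset_subset (H := H) hn)
    (((hF 1).union (hF (-1))).union (hS.union hL))).trans (Set.ncard_union_le _ _)
  have h2 := Set.ncard_union_le (monicVanishing n H 1) (monicVanishing n H (-1))
  have h3 := Set.ncard_union_le (nonlinearSplit n H) (linearSplit (n - 1) H)
  have h4 := Set.ncard_union_add_ncard_inter _ _ (hF 1) (hF (-1))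
  have h5 := Set.ncard_le_ncard (monicVanishing_inter_subset (H := H) hn) hS
  have h6 := Set.ncard_le_ncard (Set.union_subset
    (monicVanishing_subset_Rset (n := n) (H := H) (a := 1) (by omega) (by simp))
    (monicVanishing_subset_Rset (n := n) (H := H) (a := -1) (by omega) (by simp))) hR
  have h7 : (Rset n H).ncard ≤ (monicVanishing n H 1).ncard + (monicVanishing n H (-1)).ncard +
    ((nonlinearSplit n H).ncard + (linearSplit (n - 1) H).ncard) := by omega
  have h8 : (monicVanishing n H 1).ncard + (monicVanishing n H (-1)).ncard ≤
    (Rset n H).ncard + ((nonlinearSplit n H).ncard + (linearSplit (n - 1) H).ncard) := by omega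
  have h7' : ((Rset n H).ncard : ℝ) ≤ (monicVanishing n H 1).ncard +
    (monicVanishing n H (-1)).ncard +
    ((nonlinearSplit n H).ncard + (linearSplit (n - 1) H).ncard) := by exact_mod_cast h7
  have h8' : ((monicVanishing n H 1).ncard : ℝ) + (monicVanishing n H (-1)).ncard ≤
    (Rset n H).ncard + ((nonlinearSplit n H).ncard + (linearSplit (n - 1) H).ncard) := by
    exact_mod_cast h8
  rw [abs_le]
  constructor <;> linarith

theorem one_le_log_of_three_le {x : ℝ} (hx : 3 ≤ x) : 1 ≤ Real.log x := by
  rw [Real.le_log_iff_exp_le (by linarith)]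
  exact (Real.exp_one_lt_d9.le.trans (by norm_num)).trans hx

theorem exists_natLog_mul_le (k : ℕ) (hk : 1 ≤ k) :
    ∃ C₀ : ℝ, 1 ≤ C₀ ∧ ∀ H : ℕ, 3 ≤ H →
      ((Nat.log 2 (k * H) + 1 : ℕ) : ℝ) ≤ C₀ * Real.log H := by
  have hl2 : 0 < Real.log 2 := Real.log_pos (by norm_num)
  have hlk : 0 ≤ Real.log k := Real.log_nonneg (by exact_mod_cast hk)
  refine ⟨Real.log k / Real.log 2 + 1 / Real.log 2 + 1, ?_, ?_⟩
  · have : 0 ≤ Real.log k / Real.log 2 + 1 / Real.log 2 := by positivity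
    linarith
  intro H hH
  have hH' : (3 : ℝ) ≤ H := by exact_mod_cast hH
  have hL := one_le_log_of_three_le hH'
  have h1 := Real.natLog_le_logb (k * H) 2
  rw [Real.logb, Nat.cast_mul, Real.log_mul (by positivity) (by positivity), add_div] at h1
  push_cast at h1 ⊢
  have h2 : Real.log k / Real.log 2 ≤ Real.log k / Real.log 2 * Real.log H :=
    le_mul_of_one_le_right (by positivity) hL
  calc _ ≤ Real.log k / Real.log 2 * Real.log H + Real.log H / Real.log 2 + Real.log H := by
        linarith
    _ = _ := by ring

theorem stmt_6 (n : ℕ) (hn : 4 ≤ n) :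
    ∃ C : ℝ, 0 < C ∧ ∀ H : ℤ, 3 ≤ H →
      |((Rset n H).ncard : ℝ) - 2 * nu n * (H : ℝ) ^ (n - 1)| ≤
        C * (H : ℝ) ^ (n - 2) * (Real.log H) ^ (2 * n ^ 2 - 5 * n + 2) := by
  obtain ⟨Ca, hCa, hslab⟩ := exists_slabPoints_asymptotic (n - 1)
  obtain ⟨C₂, hC₂, hlin⟩ := exists_ncard_linearSplit_le (n - 1) (by omega)
  obtain ⟨Cw, hCw, hlog⟩ := exists_natLog_mul_le (n + 1) (by omega)
  set E := 2 * n ^ 2 - 5 * n + 2 with hE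
  set k := (n - 1) ^ 2 + 2 * (n - 1) - 1 with hk
  have hkE : k ≤ E := by
    obtain ⟨m, rfl⟩ : ∃ m, n = m + 4 := ⟨n - 4, by omega⟩
    have h1 : k = (m + 3) ^ 2 + 2 * (m + 3) - 1 := hk
    have h2 : E + 5 * (m + 4) = 2 * (m + 4) ^ 2 + 2 := by
      have : 5 * (m + 4) ≤ 2 * (m + 4) ^ 2 := by nlinarith
      omega
    have h3 : k + 1 = (m + 3) ^ 2 + 2 * (m + 3) := by omega
    nlinarith
  have hE1 : 1 ≤ E := by omega
  set S₀ : ℝ := (n + 1) * Cw * ((2 ^ (n + 3)) ^ n * ((n : ℝ) + 1) ^ (n - 2)) with hS₀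
  set L₀ : ℝ := C₂ * Cw ^ k * ((n : ℝ) + 1) ^ (n - 2) with hL₀
  have hS₀0 : 0 ≤ S₀ := by positivity
  have hL₀0 : 0 ≤ L₀ := by positivity
  refine ⟨2 * Ca + S₀ + L₀, by positivity, ?_⟩
  intro H' hH'
  lift H' to ℕ using by omega with H
  have hH : 3 ≤ H := by exact_mod_cast hH'
  rw [Int.cast_natCast]
  set L := Real.log H with hL
  have hL1 : 1 ≤ L := one_le_log_of_three_le (by exact_mod_cast hH)
  have hLE : ∀ j ≤ E, L ^ j ≤ L ^ E := fun j hj => pow_le_pow_right₀ hL1 hj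
  set W : ℕ := Nat.log 2 ((n + 1) * H) + 1 with hW
  have hWL : (W : ℝ) ≤ Cw * L := hlog H hH
  have hvan : ∀ a : ℤ, |a| = 1 →
      |((monicVanishing n H a).ncard : ℝ) - nu n * (H : ℝ) ^ (n - 1)| ≤
        Ca * (H : ℝ) ^ (n - 2) := by
    intro a ha
    have h1 := ncard_monicVanishing (n - 1) H (by omega) ha
    rw [Nat.sub_add_cancel (by omega)] at h1
    rw [h1]
    exact hslab H (by omega) _ (by rw [abs_pow, ha, one_pow])
  have hsplit : ((nonlinearSplit n H).ncard : ℝ) ≤ S₀ * (H : ℝ) ^ (n - 2) * L ^ E := by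
    have h1 : ((nonlinearSplit n H).ncard : ℝ) ≤
        (n + 1) * W * ((2 ^ (n + 3)) ^ n * ((n + 1) * H) ^ (n - 2)) := by
      exact_mod_cast ncard_nonlinearSplit_le n H (by omega)
    have h2 : (W : ℝ) ≤ Cw * L ^ E := by
      refine hWL.trans (mul_le_mul_of_nonneg_left ?_ (by linarith))
      simpa using hLE 1 hE1
    calc _ ≤ (n + 1) * (Cw * L ^ E) * ((2 ^ (n + 3)) ^ n * (((n : ℝ) + 1) * H) ^ (n - 2)) := by
          refine h1.trans ?_
          gcongr
      _ = _ := by rw [hS₀, mul_pow]; ring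
  have hlinear : ((linearSplit (n - 1) H).ncard : ℝ) ≤ L₀ * (H : ℝ) ^ (n - 2) * L ^ E := by
    have h1 := hlin H (by omega)
    rw [show n - 1 + 2 = n + 1 by omega, show n - 1 - 1 = n - 2 by omega] at h1
    have h2 : (W : ℝ) ^ k ≤ Cw ^ k * L ^ E := by
      refine (pow_le_pow_left₀ (by positivity) hWL k).trans ?_
      rw [mul_pow]
      exact mul_le_mul_of_nonneg_left (hLE k hkE) (by positivity)
    calc _ ≤ C₂ * (Cw ^ k * L ^ E) * (((n + 1) * H : ℕ) : ℝ) ^ (n - 2) := by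
          refine h1.trans ?_
          gcongr
      _ = _ := by
        rw [hL₀]
        push_cast
        rw [mul_pow]
        ring
  have hmain := abs_ncard_Rset_sub_le (H := H) hn
  have hp := hvan 1 (by simp)
  have hm := hvan (-1) (by simp)
  have hCL : Ca * (H : ℝ) ^ (n - 2) ≤ Ca * (H : ℝ) ^ (n - 2) * L ^ E :=
    le_mul_of_one_le_right (by positivity) (one_le_pow₀ hL1)
  rw [abs_le] at hmain hp hm ⊢
  have hexp : (2 * Ca + S₀ + L₀) * (H : ℝ) ^ (n - 2) * L ^ E = 2 * (Ca * (H : ℝ) ^ (n - 2) * L ^ E) +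
    S₀ * (H : ℝ) ^ (n - 2) * L ^ E + L₀ * (H : ℝ) ^ (n - 2) * L ^ E := by ring
  rw [hexp]
  constructor <;> linarith
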